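/- Let m ≥ 1 and N = 2m, let a_1,…,a_k be complex numbers, let g(z) = ∏_{i=1}^k (1 − a_i z), and let φ(e^{iθ}) = g(e^{iθ})·g(e^{−iθ}) with Fourier coefficients φ_n = (1/2π)∫_0^{2π} φ(e^{iθ}) e^{−inθ} dθ. Then the average over the coset O^−(N+1) = {u ∈ O(N+1) : det u = −1} of ∏_{i=1}^k det(I − a_i u) equals g(−1) · det[(φ_{j−k} + φ_{j+k+1})_{0≤j,k≤m−1}], where g(−1) = ∏_{i=1}^k (1 + a_i). -/

import Mathlib

open MeasureTheory Matrix

instance matrixMS {m n α : Type*} [MeasurableSpace α] : MeasurableSpace (Matrix m n α) :=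
  inferInstanceAs (MeasurableSpace (m → n → α))

/-- A real orthogonal matrix viewed as a complex matrix. -/
noncomputable def toC {N : ℕ} (u : Matrix.orthogonalGroup (Fin N) ℝ) :
    Matrix (Fin N) (Fin N) ℂ :=
  ((u : Matrix (Fin N) (Fin N) ℝ)).map (fun x => (x : ℂ))

/-- The symbol `φ(e^{iθ}) = g(e^{iθ}) g(e^{-iθ})` where `g(z) = ∏_i (1 - a_i z)`. -/
noncomputable def phiGG {k : ℕ} (a : Fin k → ℂ) (θ : ℝ) : ℂ :=
  (∏ i, (1 - a i * Complex.exp (Complex.I * θ))) *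
    ∏ i, (1 - a i * Complex.exp (-Complex.I * θ))

/-- The `n`-th Fourier coefficient `φ_n = (1/2π) ∫_0^{2π} φ(e^{iθ}) e^{-inθ} dθ`. -/
noncomputable def fCoeff (f : ℝ → ℂ) (n : ℤ) : ℂ :=
  ((2 * Real.pi : ℝ) : ℂ)⁻¹ *
    ∫ θ in (0 : ℝ)..(2 * Real.pi), f θ * Complex.exp (-(n : ℂ) * Complex.I * θ)


section OrthogonalTopology

variable {N : ℕ}

instance matrixBorelSpace {m n : Type*} [Countable m] [Countable n] :
    BorelSpace (Matrix m n ℝ) :=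
  inferInstanceAs (BorelSpace (m → n → ℝ))

instance orthogonalGroup_compactSpace : CompactSpace (Matrix.orthogonalGroup (Fin N) ℝ) := by
  have hK : IsCompact (Set.univ.pi fun _ : Fin N => Set.univ.pi fun _ : Fin N =>
      Set.Icc (-1 : ℝ) 1) :=
    isCompact_univ_pi fun _ => isCompact_univ_pi fun _ => isCompact_Icc
  have hclosed : IsClosed {A : Matrix (Fin N) (Fin N) ℝ | A * Aᵀ = 1} :=
    isClosed_eq (by fun_prop) continuous_const
  have hsub : {A : Matrix (Fin N) (Fin N) ℝ | A * Aᵀ = 1} ⊆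
      (Set.univ.pi fun _ : Fin N => Set.univ.pi fun _ : Fin N => Set.Icc (-1 : ℝ) 1) := by
    intro A hA i _ j _
    have h : ‖A i j‖ ≤ 1 :=
      entry_norm_bound_of_unitary (U := A) ((Matrix.mem_orthogonalGroup_iff _ _).2 hA) i j
    exact abs_le.1 h
  have hc := hK.of_isClosed_subset hclosed hsub
  refine (isCompact_iff_compactSpace (s := {A | A ∈ Matrix.orthogonalGroup (Fin N) ℝ})).1 ?_
  have hset : {A | A ∈ Matrix.orthogonalGroup (Fin N) ℝ} = {A | A * Aᵀ = 1} :=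
    Set.ext fun A => Matrix.mem_orthogonalGroup_iff _ _
  rwa [hset]

lemma integrable_of_continuous_of_compact {X E : Type*} [TopologicalSpace X] [CompactSpace X]
    [MeasurableSpace X] [BorelSpace X] [NormedAddCommGroup E] [SecondCountableTopology E]
    {μ : Measure X} [IsFiniteMeasure μ]
    {f : X → E} (hf : Continuous f) : Integrable f μ :=
  hf.integrable_of_hasCompactSupport (HasCompactSupport.of_compactSpace f)

end OrthogonalTopology

section SecondVariation

/-- If `t ↦ ∫ w ∏ (D i + sin t • α i + (1 - cos t) • β i)` is constant then its second derivative
at `0` vanishes. -/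
lemma integral_second_variation_eq_zero {X ι : Type*} [TopologicalSpace X] [CompactSpace X]
    [MeasurableSpace X] [BorelSpace X] [Fintype ι] [DecidableEq ι] (μ : Measure X)
    [IsFiniteMeasure μ] (w : C(X, ℝ)) (D α β : ι → C(X, ℝ)) (c : ℝ)
    (h : ∀ t : ℝ, ∫ x, w x * ∏ i, (D i x + Real.sin t * α i x + (1 - Real.cos t) * β i x) ∂μ = c) :
    ∫ x, w x * ∑ i, ((∏ j ∈ Finset.univ.erase i, D j x) * β i x +
      (∑ j ∈ Finset.univ.erase i, (∏ l ∈ (Finset.univ.erase i).erase j, D l x) * α j x) * α i x)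
      ∂μ = 0 := by
  let Λ : C(X, ℝ) →L[ℝ] ℝ := LinearMap.mkContinuous
    { toFun := fun f => ∫ x, f x ∂μ
      map_add' := fun f g => integral_add
        (integrable_of_continuous_of_compact f.continuous)
        (integrable_of_continuous_of_compact g.continuous)
      map_smul' := fun r f => integral_const_mul r f }
    (μ.real Set.univ) (fun f => by
      rw [mul_comm]
      exact norm_integral_le_of_norm_le_const (Filter.Eventually.of_forall f.norm_coe_le_norm))
  let M : C(X, ℝ) →L[ℝ] ℝ := Λ.comp (ContinuousLinearMap.mul ℝ C(X, ℝ) w)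
  have hM : ∀ f : C(X, ℝ), M f = ∫ x, w x * f x ∂μ := fun f => rfl
  let f : ι → ℝ → C(X, ℝ) := fun i t => D i + Real.sin t • α i + (1 - Real.cos t) • β i
  let f' : ι → ℝ → C(X, ℝ) := fun i t => Real.cos t • α i + Real.sin t • β i
  have hf : ∀ i t, HasDerivAt (f i) (f' i t) t := by
    intro i t
    have h1 := ((Real.hasDerivAt_sin t).smul_const (α i)).const_add (D i)
    have h2 := ((Real.hasDerivAt_cos t).const_sub 1).smul_const (β i)
    have h3 := h1.add h2
    rw [neg_neg] at h3
    exact h3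
  have hf' : ∀ i, HasDerivAt (f' i) (β i) 0 := by
    intro i
    have h1 := ((Real.hasDerivAt_cos 0).smul_const (α i)).add
      ((Real.hasDerivAt_sin 0).smul_const (β i))
    simp only [Real.sin_zero, neg_zero, zero_smul, Real.cos_zero, one_smul, zero_add] at h1
    exact h1
  let F' : ℝ → C(X, ℝ) := fun t => ∑ i, (∏ j ∈ Finset.univ.erase i, f j t) • f' i t
  have hF : ∀ t, HasDerivAt (fun t => ∏ i, f i t) (F' t) t := fun t =>
    HasDerivAt.fun_finsetProd fun i _ => hf i t
  have hMF : ∀ t, M (∏ i, f i t) = c := by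
    intro t
    rw [hM, ← h t]
    refine integral_congr_ae (Filter.Eventually.of_forall fun x => ?_)
    simp [f, ContinuousMap.prod_apply]
  have hMF' : ∀ t, M (F' t) = 0 := by
    intro t
    have h1 := M.hasFDerivAt.comp_hasDerivAt t (hF t)
    have h2 : (M ∘ fun t => ∏ i, f i t) = fun _ => c := funext hMF
    rw [h2] at h1
    exact h1.unique (hasDerivAt_const t c)
  have hF' : HasDerivAt F' (∑ i, ((∏ j ∈ Finset.univ.erase i, f j 0) * β i +
      (∑ j ∈ Finset.univ.erase i, (∏ l ∈ (Finset.univ.erase i).erase j, f l 0) • f' j 0) *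
        f' i 0)) 0 := by
    refine HasDerivAt.fun_sum fun i _ => ?_
    have h1 := (HasDerivAt.fun_finsetProd (u := Finset.univ.erase i)
      (fun j _ => hf j 0)).mul (hf' i)
    rw [add_comm]
    exact h1
  have h1 := M.hasFDerivAt.comp_hasDerivAt 0 hF'
  have h2 : (M ∘ F') = fun _ => 0 := funext hMF'
  rw [h2] at h1
  have h3 := h1.unique (hasDerivAt_const 0 (0 : ℝ))
  rw [hM] at h3
  rw [← h3]
  refine integral_congr_ae (Filter.Eventually.of_forall fun x => ?_)
  simp [f, f', ContinuousMap.prod_apply, ContinuousMap.sum_apply]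

end SecondVariation

section Resolvent

variable {n : Type*} [Fintype n] [DecidableEq n]

/-- The matrix `a u (1 - a u)⁻¹`. -/
noncomputable def resolventPart (a : ℝ) (u : Matrix n n ℝ) : Matrix n n ℝ :=
  (1 - a • u)⁻¹ - 1

lemma det_one_sub_smul_ne_zero {a : ℝ} (ha : |a| < 1) {u : Matrix n n ℝ} (hu : uᵀ * u = 1) :
    (1 - a • u).det ≠ 0 := by
  intro h
  obtain ⟨v, hv, hv0⟩ := Matrix.exists_mulVec_eq_zero_iff.2 h
  rw [Matrix.sub_mulVec, Matrix.one_mulVec, Matrix.smul_mulVec, sub_eq_zero] at hv0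
  have h1 : (u *ᵥ v) ⬝ᵥ (u *ᵥ v) = v ⬝ᵥ v := by
    rw [Matrix.dotProduct_mulVec, Matrix.vecMul_mulVec, hu, Matrix.vecMul_one]
  have h2 : v ⬝ᵥ v = a ^ 2 * (v ⬝ᵥ v) := by
    conv_lhs => rw [hv0, smul_dotProduct, dotProduct_smul, h1]
    simp only [smul_eq_mul]; ring
  have h3 : v ⬝ᵥ v ≠ 0 := fun h0 => hv (dotProduct_self_eq_zero.1 h0)
  have h4 : a ^ 2 = 1 := by
    have : (1 - a ^ 2) * (v ⬝ᵥ v) = 0 := by linear_combination h2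
    rcases mul_eq_zero.1 this with h | h
    · linarith
    · exact absurd h h3
  rw [← sq_abs] at h4
  nlinarith [abs_nonneg a]

lemma resolvent_mul_resolvent {a b : ℝ} {u : Matrix n n ℝ} (ha : (1 - a • u).det ≠ 0)
    (hb : (1 - b • u).det ≠ 0) :
    (a - b) • ((1 - a • u)⁻¹ * (1 - b • u)⁻¹) = a • (1 - a • u)⁻¹ - b • (1 - b • u)⁻¹ := by
  have ha' := Matrix.nonsing_inv_mul _ (Ne.isUnit ha)
  have hb' := Matrix.mul_nonsing_inv _ (Ne.isUnit hb)
  have h : (a - b) • (1 : Matrix n n ℝ) = a • (1 - b • u) - b • (1 - a • u) := by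
    rw [smul_sub, smul_sub, smul_smul, smul_smul, mul_comm b a, sub_smul]; abel
  calc (a - b) • ((1 - a • u)⁻¹ * (1 - b • u)⁻¹)
      = (1 - a • u)⁻¹ * ((a - b) • (1 : Matrix n n ℝ)) * (1 - b • u)⁻¹ := by simp
    _ = a • ((1 - a • u)⁻¹ * ((1 - b • u) * (1 - b • u)⁻¹)) -
        b • (((1 - a • u)⁻¹ * (1 - a • u)) * (1 - b • u)⁻¹) := by
      rw [h, mul_sub, sub_mul]; simp only [mul_smul_comm, smul_mul_assoc, mul_assoc]
    _ = _ := by rw [ha', hb', mul_one, one_mul]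

lemma resolvent_mul_transpose_resolvent {a b : ℝ} {u : Matrix n n ℝ} (hu : u * uᵀ = 1)
    (ha : (1 - a • u).det ≠ 0) (hb : (1 - b • u).det ≠ 0) :
    (1 - a * b) • ((1 - a • u)⁻¹ * ((1 - b • u)⁻¹)ᵀ) =
      (1 - a • u)⁻¹ + ((1 - b • u)⁻¹)ᵀ - 1 := by
  have ha' := Matrix.nonsing_inv_mul _ (Ne.isUnit ha)
  have hb' : (1 - b • u)ᵀ * ((1 - b • u)⁻¹)ᵀ = 1 := by
    rw [← Matrix.transpose_mul, Matrix.nonsing_inv_mul _ (Ne.isUnit hb), Matrix.transpose_one]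
  set B := (1 - a • u)⁻¹
  set C := ((1 - b • u)⁻¹)ᵀ
  have h : (1 - a * b) • (1 : Matrix n n ℝ) =
      (1 - b • u)ᵀ + (1 - a • u) - (1 - a • u) * (1 - b • u)ᵀ := by
    simp only [Matrix.transpose_sub, Matrix.transpose_one, Matrix.transpose_smul, mul_sub, sub_mul,
      one_mul, mul_one, smul_mul_assoc, mul_smul_comm, hu, sub_smul, smul_sub, one_smul]
    rw [mul_comm a b, mul_smul]
    abel
  calc (1 - a * b) • (B * C) = B * ((1 - a * b) • (1 : Matrix n n ℝ)) * C := by simp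
    _ = B * ((1 - b • u)ᵀ * C) + (B * (1 - a • u)) * C -
        (B * (1 - a • u)) * ((1 - b • u)ᵀ * C) := by
      rw [h]; simp only [mul_sub, sub_mul, mul_add, add_mul, mul_assoc]
    _ = B + C - 1 := by rw [ha', hb', mul_one, one_mul, one_mul]

lemma trace_resolventPart_mul {a b : ℝ} {u : Matrix n n ℝ} (ha : (1 - a • u).det ≠ 0)
    (hb : (1 - b • u).det ≠ 0) (hab : a ≠ b) :
    (resolventPart a u * resolventPart b u).trace =
      (b * (resolventPart a u).trace - a * (resolventPart b u).trace) / (a - b) := by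
  have h := congrArg Matrix.trace (resolvent_mul_resolvent ha hb)
  simp only [Matrix.trace_sub, Matrix.trace_smul, smul_eq_mul] at h
  have h0 : a - b ≠ 0 := sub_ne_zero.2 hab
  rw [eq_div_iff h0]
  simp only [resolventPart, mul_sub, sub_mul, mul_one, one_mul, Matrix.trace_sub]
  linear_combination h

lemma trace_resolventPart_mul_transpose {a b : ℝ} {u : Matrix n n ℝ} (hu : u * uᵀ = 1)
    (ha : (1 - a • u).det ≠ 0) (hb : (1 - b • u).det ≠ 0) (hab : 1 - a * b ≠ 0) :
    (resolventPart a u * (resolventPart b u)ᵀ).trace =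
      a * b / (1 - a * b) * (Fintype.card n + (resolventPart a u).trace
        + (resolventPart b u).trace) := by
  have h := congrArg Matrix.trace (resolvent_mul_transpose_resolvent hu ha hb)
  simp only [Matrix.trace_sub, Matrix.trace_smul, Matrix.trace_add, Matrix.trace_transpose,
    Matrix.trace_one, smul_eq_mul] at h
  rw [div_mul_eq_mul_div, eq_div_iff hab]
  simp only [resolventPart, mul_sub, sub_mul, mul_one, one_mul, Matrix.trace_sub,
    Matrix.transpose_sub, Matrix.transpose_one, Matrix.trace_transpose, Matrix.trace_one]
  linear_combination h

end Resolvent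

section Rotation

variable {N : ℕ}

/-- The pair of coordinates `p`, `q` as a map from `Fin 2`. -/
def coordPair (p q : Fin N) : Fin 2 → Fin N := ![p, q]

@[simp] lemma coordPair_zero (p q : Fin N) : coordPair p q 0 = p := rfl

@[simp] lemma coordPair_one (p q : Fin N) : coordPair p q 1 = q := rfl

/-- The matrix acting on the coordinates `p`, `q` by `!![c, s; -s, c]` and by `0` elsewhere. -/
def planeBlock (p q : Fin N) (s c : ℝ) : Matrix (Fin N) (Fin N) ℝ :=
  (1 : Matrix (Fin N) (Fin N) ℝ).submatrix id (coordPair p q) * !![c, s; -s, c] *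
    ((1 : Matrix (Fin N) (Fin N) ℝ).submatrix id (coordPair p q))ᵀ

lemma transpose_mul_mul_submatrix_one (A : Matrix (Fin N) (Fin N) ℝ) (v : Fin 2 → Fin N) :
    ((1 : Matrix (Fin N) (Fin N) ℝ).submatrix id v)ᵀ * A *
      (1 : Matrix (Fin N) (Fin N) ℝ).submatrix id v = A.submatrix v v := by
  ext i j
  simp [Matrix.mul_apply, Matrix.one_apply]

lemma submatrix_one_pair {p q : Fin N} (hpq : p ≠ q) :
    (1 : Matrix (Fin N) (Fin N) ℝ).submatrix (coordPair p q) (coordPair p q) = 1 := by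
  ext i j
  fin_cases i <;> fin_cases j <;>
    first
    | exact (Matrix.one_apply_eq _).trans (Matrix.one_apply_eq _).symm
    | exact Matrix.one_apply_ne hpq
    | exact Matrix.one_apply_ne hpq.symm

/-- The rotation by `t` in the plane of the coordinates `p`, `q`. -/
noncomputable def planeRotation {p q : Fin N} (hpq : p ≠ q) (t : ℝ) :
    Matrix.orthogonalGroup (Fin N) ℝ :=
  ⟨1 + planeBlock p q (Real.sin t) (Real.cos t - 1), by
    rw [Matrix.mem_orthogonalGroup_iff]
    have hW : ((1 : Matrix (Fin N) (Fin N) ℝ).submatrix id (coordPair p q))ᵀ *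
        (1 : Matrix (Fin N) (Fin N) ℝ).submatrix id (coordPair p q) = 1 := by
      have := transpose_mul_mul_submatrix_one (1 : Matrix (Fin N) (Fin N) ℝ) (coordPair p q)
      rwa [Matrix.mul_one, submatrix_one_pair hpq] at this
    simp only [planeBlock]
    set W := (1 : Matrix (Fin N) (Fin N) ℝ).submatrix id (coordPair p q)
    set K : Matrix (Fin 2) (Fin 2) ℝ :=
      !![Real.cos t - 1, Real.sin t; -Real.sin t, Real.cos t - 1] with hK
    have hKK : K + Kᵀ + K * Kᵀ = 0 := by
      have := Real.sin_sq_add_cos_sq t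
      ext i j
      fin_cases i <;> fin_cases j <;>
        simp only [hK, Matrix.add_apply, Matrix.mul_apply, Fin.sum_univ_two,
          Matrix.transpose_apply, Matrix.of_apply, Matrix.cons_val', Matrix.cons_val_zero,
          Matrix.cons_val_one, Matrix.cons_val_fin_one, Fin.zero_eta, Fin.mk_one,
          Matrix.zero_apply, Fin.isValue] <;>
        first | linear_combination this | ring
    calc (1 + W * K * Wᵀ) * (1 + W * K * Wᵀ)ᵀ
        = 1 + (W * K * Wᵀ + W * Kᵀ * Wᵀ + W * K * (Wᵀ * W) * Kᵀ * Wᵀ) := by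
          simp only [Matrix.transpose_add, Matrix.transpose_one, Matrix.transpose_mul,
            Matrix.transpose_transpose, mul_add, add_mul, mul_one, one_mul, Matrix.mul_assoc]
          abel
      _ = 1 + W * (K + Kᵀ + K * Kᵀ) * Wᵀ := by
          rw [hW]
          simp only [Matrix.mul_add, Matrix.add_mul, Matrix.mul_one, Matrix.mul_assoc]
      _ = 1 := by rw [hKK]; simp⟩

lemma det_one_sub_planeBlock_mul (p q : Fin N) (s c : ℝ) (A : Matrix (Fin N) (Fin N) ℝ) :
    (1 - planeBlock p q s c * A).det = 1 - c * (A p p + A q q) - s * (A q p - A p q) +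
      (c ^ 2 + s ^ 2) * (A p p * A q q - A p q * A q p) := by
  rw [planeBlock, Matrix.mul_assoc, Matrix.mul_assoc, det_one_sub_mul_comm, Matrix.mul_assoc,
    transpose_mul_mul_submatrix_one, Matrix.det_fin_two]
  simp only [Matrix.sub_apply, Matrix.mul_apply, Fin.sum_univ_two, Matrix.submatrix_apply,
    Matrix.of_apply, Matrix.cons_val', Matrix.cons_val_zero, Matrix.cons_val_one,
    Matrix.cons_val_fin_one, Matrix.one_apply_eq, ne_eq, zero_ne_one, one_ne_zero,
    not_false_eq_true, Matrix.one_apply_ne, coordPair_zero, coordPair_one, Fin.isValue]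
  ring

lemma det_planeRotation {p q : Fin N} (hpq : p ≠ q) (t : ℝ) :
    ((planeRotation hpq t : Matrix.orthogonalGroup (Fin N) ℝ) :
      Matrix (Fin N) (Fin N) ℝ).det = 1 := by
  have h := det_one_sub_planeBlock_mul p q (Real.sin t) (Real.cos t - 1) (-1)
  simp only [mul_neg, mul_one, sub_neg_eq_add, Matrix.neg_apply, Matrix.one_apply_eq,
    Matrix.one_apply_ne hpq, Matrix.one_apply_ne hpq.symm] at h
  rw [planeRotation, h]
  linear_combination Real.sin_sq_add_cos_sq t

/-- The characteristic polynomial along a plane rotation. -/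
lemma det_one_sub_smul_planeRotation_mul {p q : Fin N} (hpq : p ≠ q) (t : ℝ) {a : ℝ}
    {u : Matrix (Fin N) (Fin N) ℝ} (ha : (1 - a • u).det ≠ 0) :
    (1 - a • (((planeRotation hpq t : Matrix.orthogonalGroup (Fin N) ℝ) :
      Matrix (Fin N) (Fin N) ℝ) * u)).det =
    (1 - a • u).det + Real.sin t * (-(1 - a • u).det *
        (resolventPart a u q p - resolventPart a u p q)) +
      (1 - Real.cos t) * ((1 - a • u).det * (resolventPart a u p p + resolventPart a u q q +
        2 * (resolventPart a u p p * resolventPart a u q q -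
          resolventPart a u p q * resolventPart a u q p))) := by
  have hA : resolventPart a u * (1 - a • u) = a • u := by
    rw [resolventPart, sub_mul, Matrix.nonsing_inv_mul _ (Ne.isUnit ha), one_mul, sub_sub_cancel]
  have h1 : 1 - a • (((planeRotation hpq t : Matrix.orthogonalGroup (Fin N) ℝ) :
      Matrix (Fin N) (Fin N) ℝ) * u) =
      (1 - planeBlock p q (Real.sin t) (Real.cos t - 1) * resolventPart a u) * (1 - a • u) := by
    rw [sub_mul (1 : Matrix (Fin N) (Fin N) ℝ), Matrix.mul_assoc, hA, planeRotation]
    simp only [add_mul, one_mul, smul_add, mul_smul_comm]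
    abel
  rw [h1, Matrix.det_mul, det_one_sub_planeBlock_mul]
  linear_combination ((1 - a • u).det * (resolventPart a u p p * resolventPart a u q q -
          resolventPart a u p q * resolventPart a u q p)) * Real.sin_sq_add_cos_sq t

end Rotation

section LoopEquation

variable {N : ℕ}

lemma continuous_resolventPart_apply {a : ℝ} (ha : |a| < 1) (p q : Fin N) :
    Continuous fun u : Matrix.orthogonalGroup (Fin N) ℝ =>
      resolventPart a (u : Matrix (Fin N) (Fin N) ℝ) p q := by
  have h : ∀ u : Matrix.orthogonalGroup (Fin N) ℝ,
      (1 - a • (u : Matrix (Fin N) (Fin N) ℝ)).det ≠ 0 := fun u =>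
    det_one_sub_smul_ne_zero ha ((Matrix.mem_orthogonalGroup_iff' _ _).1 u.2)
  have hc : Continuous fun u : Matrix.orthogonalGroup (Fin N) ℝ =>
      1 - a • (u : Matrix (Fin N) (Fin N) ℝ) := by fun_prop
  have h1 : ∀ u : Matrix.orthogonalGroup (Fin N) ℝ,
      resolventPart a (u : Matrix (Fin N) (Fin N) ℝ) p q =
        (1 - a • (u : Matrix (Fin N) (Fin N) ℝ)).det⁻¹ *
          (1 - a • (u : Matrix (Fin N) (Fin N) ℝ)).adjugate p q -
        (1 : Matrix (Fin N) (Fin N) ℝ) p q := by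
    intro u
    rw [resolventPart, Matrix.inv_def, Ring.inverse_eq_inv']
    rfl
  simp only [h1]
  exact ((hc.matrix_det.inv₀ h).mul (hc.matrix_adjugate.matrix_elem p q)).sub continuous_const

/-- The trace expression produced by the second variation in all coordinate planes. -/
noncomputable def loopTerm {k : ℕ} (a : Fin k → ℝ) (u : Matrix (Fin N) (Fin N) ℝ) : ℝ :=
  ∑ i, (((N : ℝ) - 1) * (resolventPart (a i) u).trace + (resolventPart (a i) u).trace ^ 2 -
      (resolventPart (a i) u * resolventPart (a i) u).trace) +
    ∑ i, ∑ j ∈ Finset.univ.erase i,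
      ((resolventPart (a i) u * (resolventPart (a j) u)ᵀ).trace -
        (resolventPart (a i) u * resolventPart (a j) u).trace)

/-- The contribution of the coordinate plane `p`, `q`. -/
noncomputable def planeTerm {k : ℕ} (a : Fin k → ℝ) (u : Matrix (Fin N) (Fin N) ℝ)
    (p q : Fin N) : ℝ :=
  ∑ i, ((resolventPart (a i) u p p + resolventPart (a i) u q q +
        2 * (resolventPart (a i) u p p * resolventPart (a i) u q q -
          resolventPart (a i) u p q * resolventPart (a i) u q p)) +
    ∑ j ∈ Finset.univ.erase i, (resolventPart (a i) u q p - resolventPart (a i) u p q) *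
      (resolventPart (a j) u q p - resolventPart (a j) u p q))

lemma sum_planeTerm {k : ℕ} (a : Fin k → ℝ) (u : Matrix (Fin N) (Fin N) ℝ) :
    ∑ p, ∑ q ∈ Finset.univ.erase p, planeTerm a u p q = 2 * loopTerm a u := by
  have h0 : ∀ p, ∑ q ∈ Finset.univ.erase p, planeTerm a u p q =
      ∑ q, planeTerm a u p q - ∑ i, 2 * resolventPart (a i) u p p := by
    intro p
    rw [← Finset.add_sum_erase _ _ (Finset.mem_univ p), eq_sub_iff_add_eq, add_comm]
    congr 1
    unfold planeTerm
    refine Finset.sum_congr rfl fun i _ => ?_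
    simp only [sub_self, zero_mul, Finset.sum_const_zero]
    ring
  have htr : ∀ A : Matrix (Fin N) (Fin N) ℝ, ∑ p, A p p = A.trace := fun A => rfl
  have hmul : ∀ A B : Matrix (Fin N) (Fin N) ℝ, ∑ p, ∑ q, A p q * B q p = (A * B).trace := by
    intro A B
    simp [Matrix.trace, Matrix.mul_apply]
  have hκ : ∀ A : Matrix (Fin N) (Fin N) ℝ, ∑ p, ∑ q, (A p p + A q q +
      2 * (A p p * A q q - A p q * A q p)) =
      2 * (N * A.trace + A.trace ^ 2 - (A * A).trace) := by
    intro A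
    rw [← hmul]
    simp only [Finset.sum_add_distrib, ← Finset.mul_sum, Finset.sum_sub_distrib,
      Finset.sum_const, Finset.card_univ, Fintype.card_fin, nsmul_eq_mul, ← Finset.sum_mul, htr]
    ring
  have hτ : ∀ A B : Matrix (Fin N) (Fin N) ℝ,
      ∑ p, ∑ q, (A q p - A p q) * (B q p - B p q) = 2 * ((A * Bᵀ).trace - (A * B).trace) := by
    intro A B
    have e1 : ∑ p, ∑ q, A q p * B q p = (A * Bᵀ).trace := by
      rw [Finset.sum_comm, ← hmul]; rfl
    have e2 : ∑ p, ∑ q, A p q * B p q = (A * Bᵀ).trace := by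
      rw [← hmul]; rfl
    have e3 : ∑ p, ∑ q, A q p * B p q = (A * B).trace := by
      rw [Finset.sum_comm, ← hmul]
    have e4 := hmul A B
    simp only [sub_mul, mul_sub, Finset.sum_sub_distrib, e1, e2, e3, e4]
    ring
  simp only [h0, Finset.sum_sub_distrib]
  have h1 : ∑ p, ∑ q, planeTerm a u p q = ∑ i, (∑ p, ∑ q, (resolventPart (a i) u p p +
      resolventPart (a i) u q q + 2 * (resolventPart (a i) u p p * resolventPart (a i) u q q -
          resolventPart (a i) u p q * resolventPart (a i) u q p)) +
      ∑ j ∈ Finset.univ.erase i, ∑ p, ∑ q,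
      (resolventPart (a i) u q p - resolventPart (a i) u p q) *
      (resolventPart (a j) u q p - resolventPart (a j) u p q)) := by
    unfold planeTerm
    rw [Finset.sum_congr rfl fun p _ => Finset.sum_comm, Finset.sum_comm]
    refine Finset.sum_congr rfl fun i _ => ?_
    simp only [Finset.sum_add_distrib]
    congr 1
    rw [Finset.sum_congr rfl fun p _ => Finset.sum_comm, Finset.sum_comm]
  rw [h1, Finset.sum_comm (f := fun p i => 2 * resolventPart (a i) u p p)]
  simp only [hκ, hτ]
  simp only [← Finset.mul_sum, htr, loopTerm, Finset.sum_add_distrib, Finset.sum_sub_distrib]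
  ring

lemma continuous_planeTerm {k : ℕ} {a : Fin k → ℝ} (ha : ∀ i, |a i| < 1) (p q : Fin N) :
    Continuous fun u : Matrix.orthogonalGroup (Fin N) ℝ =>
      planeTerm a (u : Matrix (Fin N) (Fin N) ℝ) p q := by
  have := fun i p q => continuous_resolventPart_apply (N := N) (ha i) p q
  unfold planeTerm
  fun_prop

variable (μ : Measure (Matrix.orthogonalGroup (Fin N) ℝ)) [IsFiniteMeasure μ]
  [μ.IsMulLeftInvariant]

lemma integral_planeTerm_eq_zero {k : ℕ} {a : Fin k → ℝ} (ha : ∀ i, |a i| < 1) {p q : Fin N}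
    (hpq : p ≠ q) :
    ∫ u : Matrix.orthogonalGroup (Fin N) ℝ, (1 - (u : Matrix (Fin N) (Fin N) ℝ).det) *
      ((∏ i, (1 - a i • (u : Matrix (Fin N) (Fin N) ℝ)).det) *
        planeTerm a (u : Matrix (Fin N) (Fin N) ℝ) p q) ∂μ = 0 := by
  have hA := fun i p q => continuous_resolventPart_apply (N := N) (ha i) p q
  have hdet : ∀ i, Continuous fun u : Matrix.orthogonalGroup (Fin N) ℝ =>
      (1 - a i • (u : Matrix (Fin N) (Fin N) ℝ)).det := fun i =>
    Continuous.matrix_det (by fun_prop)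
  let w : C(Matrix.orthogonalGroup (Fin N) ℝ, ℝ) :=
    ⟨fun u => 1 - (u : Matrix (Fin N) (Fin N) ℝ).det, by
      have : Continuous fun u : Matrix.orthogonalGroup (Fin N) ℝ =>
        (u : Matrix (Fin N) (Fin N) ℝ).det := continuous_subtype_val.matrix_det
      fun_prop⟩
  let D : Fin k → C(Matrix.orthogonalGroup (Fin N) ℝ, ℝ) := fun i =>
    ⟨fun u => (1 - a i • (u : Matrix (Fin N) (Fin N) ℝ)).det, hdet i⟩
  let τ : Fin k → C(Matrix.orthogonalGroup (Fin N) ℝ, ℝ) := fun i =>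
    ⟨fun u => -(1 - a i • (u : Matrix (Fin N) (Fin N) ℝ)).det *
        (resolventPart (a i) (u : Matrix (Fin N) (Fin N) ℝ) q p -
          resolventPart (a i) (u : Matrix (Fin N) (Fin N) ℝ) p q), by fun_prop⟩
  let κ : Fin k → C(Matrix.orthogonalGroup (Fin N) ℝ, ℝ) := fun i =>
    ⟨fun u => (1 - a i • (u : Matrix (Fin N) (Fin N) ℝ)).det *
      (resolventPart (a i) (u : Matrix (Fin N) (Fin N) ℝ) p p +
        resolventPart (a i) (u : Matrix (Fin N) (Fin N) ℝ) q q +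
        2 * (resolventPart (a i) (u : Matrix (Fin N) (Fin N) ℝ) p p *
          resolventPart (a i) (u : Matrix (Fin N) (Fin N) ℝ) q q -
          resolventPart (a i) (u : Matrix (Fin N) (Fin N) ℝ) p q *
          resolventPart (a i) (u : Matrix (Fin N) (Fin N) ℝ) q p)), by fun_prop⟩
  have key := integral_second_variation_eq_zero μ w D τ κ
    (∫ u, w u * ∏ i, D i u ∂μ) (fun t => by
      rw [← integral_mul_left_eq_self (fun u => w u * ∏ i, D i u) (planeRotation hpq t)]
      refine integral_congr_ae (Filter.Eventually.of_forall fun u => ?_)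
      have hw : w (planeRotation hpq t * u) = w u := by
        simp only [w, ContinuousMap.coe_mk, Submonoid.coe_mul, Matrix.det_mul, det_planeRotation,
          one_mul]
      simp only [hw]
      congr 1
      refine Finset.prod_congr rfl fun i _ => ?_
      exact (det_one_sub_smul_planeRotation_mul hpq t (det_one_sub_smul_ne_zero (ha i)
        ((Matrix.mem_orthogonalGroup_iff' _ _).1 u.2))).symm.trans rfl)
  rw [← key]
  refine integral_congr_ae (Filter.Eventually.of_forall fun u => ?_)
  change w u * ((∏ i, D i u) * _) = _
  congr 1
  rw [planeTerm, Finset.mul_sum]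
  refine Finset.sum_congr rfl fun i _ => ?_
  rw [mul_add]
  congr 1
  · rw [← Finset.prod_erase_mul _ _ (Finset.mem_univ i), mul_assoc]
    rfl
  · rw [Finset.mul_sum, Finset.sum_mul]
    refine Finset.sum_congr rfl fun j hj => ?_
    rw [← Finset.prod_erase_mul _ _ (Finset.mem_univ i), ← Finset.prod_erase_mul _ _ hj]
    simp only [D, τ, ContinuousMap.coe_mk]
    ring

/-- The loop equation. -/
lemma integral_loopTerm_eq_zero {k : ℕ} {a : Fin k → ℝ} (ha : ∀ i, |a i| < 1) :
    ∫ u : Matrix.orthogonalGroup (Fin N) ℝ, (1 - (u : Matrix (Fin N) (Fin N) ℝ).det) *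
      ((∏ i, (1 - a i • (u : Matrix (Fin N) (Fin N) ℝ)).det) *
        loopTerm a (u : Matrix (Fin N) (Fin N) ℝ)) ∂μ = 0 := by
  have hdet : ∀ i, Continuous fun u : Matrix.orthogonalGroup (Fin N) ℝ =>
      (1 - a i • (u : Matrix (Fin N) (Fin N) ℝ)).det := fun i =>
    Continuous.matrix_det (by fun_prop)
  have hdet' : Continuous fun u : Matrix.orthogonalGroup (Fin N) ℝ =>
    (u : Matrix (Fin N) (Fin N) ℝ).det := continuous_subtype_val.matrix_det
  have hp := continuous_planeTerm (N := N) ha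
  have h : ∑ p : Fin N, ∑ q ∈ Finset.univ.erase p,
      ∫ u : Matrix.orthogonalGroup (Fin N) ℝ, (1 - (u : Matrix (Fin N) (Fin N) ℝ).det) *
      ((∏ i, (1 - a i • (u : Matrix (Fin N) (Fin N) ℝ)).det) *
        planeTerm a (u : Matrix (Fin N) (Fin N) ℝ) p q) ∂μ = 0 :=
    Finset.sum_eq_zero fun p _ => Finset.sum_eq_zero fun q hq =>
      integral_planeTerm_eq_zero μ ha (Finset.ne_of_mem_erase hq).symm
  have hint : ∀ p q : Fin N, Integrable (fun u : Matrix.orthogonalGroup (Fin N) ℝ =>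
      (1 - (u : Matrix (Fin N) (Fin N) ℝ).det) *
      ((∏ i, (1 - a i • (u : Matrix (Fin N) (Fin N) ℝ)).det) *
        planeTerm a (u : Matrix (Fin N) (Fin N) ℝ) p q)) μ := fun p q =>
    integrable_of_continuous_of_compact (by fun_prop)
  rw [Finset.sum_congr rfl fun p _ => (integral_finsetSum _ fun q _ => hint p q).symm,
    ← integral_finsetSum _ fun p _ => integrable_finsetSum _ fun q _ => hint p q] at h
  simp only [← Finset.mul_sum, sum_planeTerm] at h
  have h2 : ∀ x y z : ℝ, x * (y * (2 * z)) = 2 * (x * (y * z)) := fun x y z => by ring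
  simp only [h2, integral_const_mul] at h
  linarith

end LoopEquation

section CharpolyDerivatives

variable {n : Type*} [Fintype n] [DecidableEq n]

lemma eval_charpolyRev_eq_det {R : Type*} [CommRing R] (u : Matrix n n R) (a : R) :
    u.charpolyRev.eval a = (1 - a • u).det := by
  rw [Matrix.charpolyRev, ← Polynomial.coe_evalRingHom, RingHom.map_det]
  congr 1
  ext i j
  by_cases hij : i = j <;> simp [hij, mul_comm a]

lemma eval_derivative_charpolyRev {u : Matrix n n ℝ} {a : ℝ} (ha : (1 - a • u).det ≠ 0) :
    a * u.charpolyRev.derivative.eval a =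
      -(resolventPart a u).trace * u.charpolyRev.eval a := by
  obtain ⟨B, hB⟩ : ∃ B, B = (1 - a • u)⁻¹ := ⟨_, rfl⟩
  have hBm : B * (1 - a • u) = 1 := by rw [hB, Matrix.nonsing_inv_mul _ (Ne.isUnit ha)]
  have h1 : ∀ b, u.charpolyRev.eval b =
      (1 + (b - a) • (-(u * B))).det * u.charpolyRev.eval a := by
    intro b
    rw [eval_charpolyRev_eq_det, eval_charpolyRev_eq_det, ← Matrix.det_mul]
    congr 1
    rw [add_mul, one_mul, smul_mul_assoc, neg_mul, mul_assoc, hBm, mul_one, smul_neg, sub_smul]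
    abel
  set Q := (Matrix.det (1 + (Polynomial.X : Polynomial ℝ) •
    (-(u * B)).map Polynomial.C)).divX.divX
  have h2 : ∀ b, u.charpolyRev.eval b = (1 + (-(u * B)).trace * (b - a) +
      Q.eval (b - a) * (b - a) ^ 2) * u.charpolyRev.eval a := by
    intro b
    rw [h1 b, Matrix.det_one_add_smul]
  have h3 : u.charpolyRev = (1 + Polynomial.C (-(u * B)).trace *
      (Polynomial.X - Polynomial.C a) + Q.comp (Polynomial.X - Polynomial.C a) *
      (Polynomial.X - Polynomial.C a) ^ 2) * Polynomial.C (u.charpolyRev.eval a) := by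
    refine Polynomial.funext fun b => ?_
    rw [h2 b]
    simp [Polynomial.eval_comp]
  have h4 : u.charpolyRev.derivative.eval a = (-(u * B)).trace * u.charpolyRev.eval a := by
    have := congrArg (fun p => (Polynomial.derivative p).eval a) h3
    simp only [Polynomial.derivative_mul, Polynomial.derivative_add, Polynomial.derivative_sub,
      Polynomial.derivative_pow, Polynomial.derivative_one, Polynomial.derivative_C,
      Polynomial.derivative_X] at this
    rw [this]
    simp
  have h5 : resolventPart a u = a • (u * B) := by
    have : (resolventPart a u - a • (u * B)) * (1 - a • u) = 0 := by
      rw [resolventPart, ← hB, sub_mul, sub_mul, hBm, smul_mul_assoc, mul_assoc, hBm]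
      simp
    have h6 := congrArg (· * B) this
    have hBm' : (1 - a • u) * B = 1 := by rw [hB, Matrix.mul_nonsing_inv _ (Ne.isUnit ha)]
    simpa only [mul_assoc, hBm', mul_one, zero_mul, sub_eq_zero] using h6
  rw [h4, h5]
  simp only [Matrix.trace_neg, Matrix.trace_smul, smul_eq_mul]
  ring

lemma hasDerivAt_mul_trace_inv {u : Matrix n n ℝ} {a : ℝ} (ha : (1 - a • u).det ≠ 0) :
    HasDerivAt (fun b : ℝ => b * ((1 - b • u)⁻¹).trace)
      ((1 - a • u)⁻¹ * (1 - a • u)⁻¹).trace a := by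
  have hc : Continuous fun b : ℝ => 1 - b • u := by fun_prop
  have hinv : ContinuousAt (fun b : ℝ => (1 - b • u)⁻¹) a := by
    have : (fun b : ℝ => (1 - b • u)⁻¹) =
        fun b : ℝ => (1 - b • u).det⁻¹ • (1 - b • u).adjugate := by
      funext b
      rw [Matrix.inv_def, Ring.inverse_eq_inv']
    rw [this]
    exact (hc.matrix_det.continuousAt.inv₀ ha).smul hc.matrix_adjugate.continuousAt
  have hne : ∀ᶠ b in nhds a, (1 - b • u).det ≠ 0 :=
    hc.matrix_det.continuousAt.eventually_ne ha
  rw [hasDerivAt_iff_tendsto_slope]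
  have hlim : Filter.Tendsto (fun b => ((1 - a • u)⁻¹ * (1 - b • u)⁻¹).trace) (nhds a)
      (nhds ((1 - a • u)⁻¹ * (1 - a • u)⁻¹).trace) := by
    have : ContinuousAt (fun b => ((1 - a • u)⁻¹ * (1 - b • u)⁻¹).trace) a :=
      (Continuous.matrix_trace continuous_id).continuousAt.comp (continuousAt_const.mul hinv)
    exact this
  refine (hlim.mono_left nhdsWithin_le_nhds).congr' ?_
  filter_upwards [hne.filter_mono nhdsWithin_le_nhds, self_mem_nhdsWithin] with b hb hba
  have hba' : b ≠ a := hba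
  have h := congrArg Matrix.trace (resolvent_mul_resolvent ha hb)
  simp only [Matrix.trace_sub, Matrix.trace_smul, smul_eq_mul] at h
  rw [slope_def_field, eq_div_iff (sub_ne_zero.2 hba')]
  linear_combination -h

lemma eval_second_derivative_charpolyRev {u : Matrix n n ℝ} {a : ℝ}
    (ha : (1 - a • u).det ≠ 0) :
    a ^ 2 * u.charpolyRev.derivative.derivative.eval a + a * u.charpolyRev.derivative.eval a =
      ((resolventPart a u).trace ^ 2 - (resolventPart a u).trace -
        (resolventPart a u * resolventPart a u).trace) * u.charpolyRev.eval a := by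
  set P := u.charpolyRev with hP
  have hc : Continuous fun b : ℝ => 1 - b • u := by fun_prop
  have hne : ∀ᶠ b in nhds a, (1 - b • u).det ≠ 0 :=
    hc.matrix_det.continuousAt.eventually_ne ha
  have heq : (fun b : ℝ => b ^ 2 * P.derivative.eval b) =ᶠ[nhds a]
      fun b => (b * Fintype.card n - b * ((1 - b • u)⁻¹).trace) * P.eval b := by
    filter_upwards [hne] with b hb
    have := eval_derivative_charpolyRev hb
    simp only [resolventPart, Matrix.trace_sub, Matrix.trace_one] at this
    linear_combination b * this
  have h1 : HasDerivAt (fun b : ℝ => b ^ 2 * P.derivative.eval b)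
      ((2 * a) * P.derivative.eval a + a ^ 2 * P.derivative.derivative.eval a) a := by
    have := (hasDerivAt_pow 2 a).fun_mul (P.derivative.hasDerivAt a)
    simpa only [Nat.cast_ofNat, Nat.add_one_sub_one, pow_one] using this
  have h2 := (((hasDerivAt_id a).mul_const (Fintype.card n : ℝ)).sub
    (hasDerivAt_mul_trace_inv ha)).mul (P.hasDerivAt a)
  have h3 := h1.unique (h2.congr_of_eventuallyEq heq)
  have h4 := eval_derivative_charpolyRev ha
  have h5 : (resolventPart a u * resolventPart a u).trace =
      ((1 - a • u)⁻¹ * (1 - a • u)⁻¹).trace - 2 * (resolventPart a u).trace -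
        Fintype.card n := by
    simp only [resolventPart, mul_sub, sub_mul, mul_one, one_mul, Matrix.trace_sub,
      Matrix.trace_one]
    ring
  have h6 : ((1 - a • u)⁻¹).trace = (resolventPart a u).trace + Fintype.card n := by
    simp only [resolventPart, Matrix.trace_sub, Matrix.trace_one]
    ring
  simp only [id_eq, h6, Pi.sub_apply] at h3
  rw [← hP] at h4
  rw [h5]
  linear_combination h3 - (1 + (resolventPart a u).trace) * h4

end CharpolyDerivatives

section DeterminantRows

open Polynomial

lemma det_updateRow_eq_sum_adjugate {ι R : Type*} [Fintype ι] [DecidableEq ι] [CommRing R]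
    (V : Matrix ι ι R) (i : ι) (v : ι → R) :
    (V.updateRow i v).det = ∑ j, v j * V.adjugate j i := by
  rw [← Matrix.cramer_transpose_apply, Matrix.cramer_eq_adjugate_mulVec,
    ← Matrix.adjugate_transpose]
  simp [Matrix.mulVec, dotProduct, mul_comm]

lemma sum_det_updateRow_mul {ι R : Type*} [Fintype ι] [DecidableEq ι] [CommRing R]
    (V A : Matrix ι ι R) :
    ∑ i, (V.updateRow i ((V * A) i)).det = A.trace * V.det := by
  have h : ∑ i, (V.updateRow i ((V * A) i)).det = (V * A * V.adjugate).trace := by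
    simp only [det_updateRow_eq_sum_adjugate, Matrix.trace, Matrix.diag]
    rfl
  rw [h, Matrix.trace_mul_comm, ← Matrix.mul_assoc, Matrix.adjugate_mul]
  simp [mul_comm]

lemma sum_det_updateRow_vandermonde_euler {k : ℕ} (x : Fin k → ℝ) :
    ∑ i, ((Matrix.vandermonde x).updateRow i (fun j => (j : ℝ) ^ 2 * x i ^ (j : ℕ) -
      4 * ((j : ℝ) * (j - 1)) * x i ^ ((j : ℕ) - 2))).det =
      (∑ j : Fin k, (j : ℝ) ^ 2) * (Matrix.vandermonde x).det := by
  let A : Matrix (Fin k) (Fin k) ℝ := Matrix.of fun l j =>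
    (if l = j then (j : ℝ) ^ 2 else 0) -
      (if (l : ℕ) + 2 = j then 4 * ((j : ℝ) * (j - 1)) else 0)
  have hA : A.trace = ∑ j : Fin k, (j : ℝ) ^ 2 := by
    refine Finset.sum_congr rfl fun j _ => ?_
    simp [A]
  rw [← hA, ← sum_det_updateRow_mul]
  refine Finset.sum_congr rfl fun i _ => ?_
  congr 2
  funext j
  rw [Matrix.mul_apply]
  simp only [A, Matrix.of_apply, Matrix.vandermonde_apply, mul_sub, Finset.sum_sub_distrib,
    mul_ite, mul_zero, Finset.sum_ite_eq', Finset.mem_univ, if_true]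
  congr 1
  · ring
  by_cases hj : 2 ≤ (j : ℕ)
  · rw [Finset.sum_eq_single (⟨(j : ℕ) - 2, by omega⟩ : Fin k)]
    · simp [Nat.sub_add_cancel hj]; ring
    · intro l _ hl
      rw [if_neg]
      intro h
      apply hl
      ext
      simp only
      omega
    · simp
  · rw [Finset.sum_eq_zero]
    · have : (j : ℕ) = 0 ∨ (j : ℕ) = 1 := by omega
      rcases this with h | h <;> simp [h]
    · intro l _
      rw [if_neg (by omega)]

lemma det_updateRow_vandermonde_derivative {k : ℕ} {x : Fin k → ℝ} (hx : Function.Injective x)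
    (i : Fin k) :
    ((Matrix.vandermonde x).updateRow i (fun j => (j : ℝ) * x i ^ ((j : ℕ) - 1))).det =
      (∑ j ∈ Finset.univ.erase i, (x i - x j)⁻¹) * (Matrix.vandermonde x).det := by
  let V := Matrix.vandermonde x
  let p : ℝ[X] := ∑ j : Fin k, C (V.adjugate j i) * X ^ (j : ℕ)
  have hp : p = C V.det * Lagrange.basis Finset.univ x i := by
    refine Polynomial.eq_of_degrees_lt_of_eval_index_eq Finset.univ hx.injOn ?_ ?_ ?_
    · rw [Finset.card_univ, Fintype.card_fin, Polynomial.degree_lt_iff_coeff_zero]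
      intro l hl
      simp only [p, finsetSum_coeff, coeff_C_mul, coeff_X_pow]
      exact Finset.sum_eq_zero fun j _ => by rw [if_neg (by omega), mul_zero]
    · refine lt_of_le_of_lt
        (smul_eq_C_mul (p := Lagrange.basis Finset.univ x i) V.det ▸ degree_smul_le _ _) ?_
      rw [Lagrange.degree_basis hx.injOn (Finset.mem_univ i)]
      have := Fin.pos i
      simp only [Finset.card_univ, Fintype.card_fin]
      exact_mod_cast Nat.sub_lt this one_pos
    · intro l _
      have h1 : p.eval (x l) = (V * V.adjugate) l i := by
        simp only [p, eval_finsetSum, Matrix.mul_apply, eval_mul, eval_C, eval_pow, eval_X]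
        exact Finset.sum_congr rfl fun j _ => mul_comm _ _
      rw [h1, Matrix.mul_adjugate]
      by_cases hl : l = i
      · subst hl
        simp [Lagrange.eval_basis_self hx.injOn]
      · simp [hl, Lagrange.eval_basis_of_ne (Ne.symm hl)]
  have h2 : ((Matrix.vandermonde x).updateRow i (fun j => (j : ℝ) * x i ^ ((j : ℕ) - 1))).det =
      p.derivative.eval (x i) := by
    rw [det_updateRow_eq_sum_adjugate]
    simp only [p, derivative_sum, eval_finsetSum, derivative_C_mul, derivative_X_pow, eval_mul,
      eval_C, eval_pow, eval_X]
    exact Finset.sum_congr rfl fun j _ => by ring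
  rw [h2, hp, derivative_C_mul, eval_C_mul, mul_comm]
  congr 1
  rw [Lagrange.basis, derivative_prod_finset, eval_finsetSum]
  refine Finset.sum_congr rfl fun j hj => ?_
  rw [eval_mul, eval_prod, Finset.prod_eq_one]
  · simp [Lagrange.basisDivisor]
  · intro l hl
    have hl' : l ≠ i := Finset.ne_of_mem_erase (Finset.mem_of_mem_erase hl)
    exact Lagrange.eval_basisDivisor_left_of_ne fun h => hl' (hx h).symm

lemma det_of_sum_smul {ι κ R : Type*} [Fintype ι] [DecidableEq ι] [Fintype κ] [CommRing R]
    (ω : ι → κ → R) (g : κ → ι → R) :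
    (Matrix.of fun i j => ∑ n, ω i n * g n j).det =
      ∑ n : ι → κ, (∏ i, ω i (n i)) * (Matrix.of fun i j => g (n i) j).det := by
  have h := (Matrix.detRowAlternating (R := R) (n := ι)).toMultilinearMap.map_sum
    (fun i n => ω i n • g n)
  have h1 : (fun i => ∑ n, ω i n • g n) = fun i j => ∑ n, ω i n * g n j := by
    funext i j
    simp
  rw [h1] at h
  refine Eq.trans h (Finset.sum_congr rfl fun n _ => ?_)
  exact (Matrix.detRowAlternating (R := R) (n := ι)).toMultilinearMap.map_smul_univ
    (fun i => ω i (n i)) (fun i => g (n i))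

lemma eq_zero_of_sum_mul_prod_pow_eq_zero {k M : ℕ} {S : Fin k → Set ℝ}
    (hS : ∀ i, (S i).Infinite) {c : (Fin k → Fin M) → ℝ}
    (h : ∀ a : Fin k → ℝ, (∀ i, a i ∈ S i) → ∑ n, (∏ i, a i ^ (n i : ℕ)) * c n = 0)
    (n : Fin k → Fin M) : c n = 0 := by
  let e : (Fin k → Fin M) → (Fin k →₀ ℕ) := fun n =>
    Finsupp.equivFunOnFinite.symm fun i => (n i : ℕ)
  have he : Function.Injective e := by
    intro n n' hn
    funext i
    exact Fin.ext (DFunLike.congr_fun hn i)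
  let p : MvPolynomial (Fin k) ℝ := ∑ n, MvPolynomial.monomial (e n) (c n)
  have hp : p = 0 := by
    refine MvPolynomial.funext_set S hS fun a ha => ?_
    rw [map_zero, ← h a fun i => ha i (Set.mem_univ i)]
    simp only [p, map_sum, MvPolynomial.eval_monomial]
    refine Finset.sum_congr rfl fun n _ => ?_
    rw [mul_comm, Finsupp.prod_fintype _ _ fun i => pow_zero _]
    rfl
  have h1 : p.coeff (e n) = c n := by
    simp only [p, MvPolynomial.coeff_sum, MvPolynomial.coeff_monomial]
    rw [Finset.sum_eq_single n]
    · simp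
    · intro n' _ hn'
      rw [if_neg fun h => hn' (he h)]
    · simp
  rw [← h1, hp, MvPolynomial.coeff_zero]

end DeterminantRows

section RowPolynomials

open Polynomial

/-- The polynomial whose values are `z ^ K * (z + z⁻¹) ^ j * P(z)`. -/
noncomputable def rowPoly {R : Type*} [CommRing R] (K : ℕ) (P : R[X]) (j : ℕ) : R[X] :=
  (1 + X ^ 2) ^ j * X ^ (K - j) * P

lemma natDegree_rowPoly_le {R : Type*} [CommRing R] {K N j : ℕ} (hj : j ≤ K) {P : R[X]}
    (hP : P.natDegree ≤ N) : (rowPoly K P j).natDegree ≤ N + 2 * K := by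
  have h1 : ((1 + X ^ 2 : R[X])).natDegree ≤ 2 := by compute_degree
  have h2 : ((1 + X ^ 2 : R[X]) ^ j).natDegree ≤ j * 2 := natDegree_pow_le_of_le j h1
  have h3 : ((X : R[X]) ^ (K - j)).natDegree ≤ K - j := natDegree_X_pow_le _
  refine (natDegree_mul_le_of_le (natDegree_mul_le_of_le h2 h3) hP).trans ?_
  omega

lemma eval_rowPoly {F : Type*} [Field F] {K j : ℕ} (hj : j ≤ K) (P : F[X]) {a : F} (ha : a ≠ 0) :
    (rowPoly K P j).eval a = a ^ K * (a + a⁻¹) ^ j * P.eval a := by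
  have h : 1 + a ^ 2 = a * (a + a⁻¹) := by field_simp; ring
  simp only [rowPoly, eval_mul, eval_pow, eval_add, eval_one, eval_X]
  rw [h, mul_pow]
  obtain ⟨l, rfl⟩ := Nat.exists_eq_add_of_le hj
  rw [Nat.add_sub_cancel_left]
  ring

lemma sum_sq_mul_coeff_mul_pow {M : ℕ} {f : ℝ[X]} (hf : f.natDegree ≤ M) (a : ℝ) :
    ∑ n : Fin (M + 1), ((n : ℝ) - M / 2) ^ 2 * a ^ (n : ℕ) * f.coeff n =
      a ^ 2 * f.derivative.derivative.eval a + a * f.derivative.eval a -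
        M * (a * f.derivative.eval a) + (M : ℝ) ^ 2 / 4 * f.eval a := by
  have h := f.as_sum_range' (M + 1) (by omega)
  rw [Fin.sum_univ_eq_sum_range (fun n => ((n : ℝ) - M / 2) ^ 2 * a ^ n * f.coeff n)]
  conv_rhs => rw [h]
  simp only [derivative_sum, derivative_monomial, eval_finsetSum, eval_monomial, Finset.mul_sum,
    ← Finset.sum_add_distrib, ← Finset.sum_sub_distrib]
  refine Finset.sum_congr rfl fun n _ => ?_
  rcases n with _ | _ | n
  · simp only [Nat.cast_zero, pow_zero]
    ring
  · simp; ring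
  · simp only [Nat.add_sub_cancel]
    push_cast
    ring

lemma mul_derivative_one_add_sq_pow_mul_pow {K j : ℕ} (hj : j ≤ K) :
    (1 + X ^ 2) * X * derivative ((1 + X ^ 2 : ℝ[X]) ^ j * X ^ (K - j)) =
      (C ((K : ℝ) + j) * X ^ 2 + C ((K : ℝ) - j)) * ((1 + X ^ 2 : ℝ[X]) ^ j * X ^ (K - j)) := by
  obtain ⟨l, rfl⟩ := Nat.exists_eq_add_of_le hj
  rw [Nat.add_sub_cancel_left]
  simp only [derivative_mul, derivative_pow, derivative_add, derivative_one, derivative_X]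
  rcases j with _ | j <;> rcases l with _ | l <;>
    simp [show (C (2 : ℝ) : ℝ[X]) = 2 from rfl] <;> ring

/-- The Euler-type operator on the row polynomials. -/
lemma euler_rowPoly {K N j : ℕ} (hj : j ≤ K) {P : ℝ[X]} (hP : P.natDegree ≤ N) {a : ℝ}
    (ha : a ≠ 0) :
    ∑ n : Fin (N + 2 * K + 1), ((n : ℝ) - ((N + 2 * K : ℕ) : ℝ) / 2) ^ 2 * a ^ (n : ℕ) *
      (rowPoly K P j).coeff n =
    a ^ K * (((j : ℝ) ^ 2 * (a + a⁻¹) ^ j - 4 * ((j : ℝ) * (j - 1)) * (a + a⁻¹) ^ (j - 2)) *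
        P.eval a +
      (j : ℝ) * (a + a⁻¹) ^ (j - 1) * ((a - a⁻¹) * (2 * (a * P.derivative.eval a) -
        N * P.eval a)) +
      (a + a⁻¹) ^ j * (a ^ 2 * P.derivative.derivative.eval a + a * P.derivative.eval a -
        N * (a * P.derivative.eval a) + (N : ℝ) ^ 2 / 4 * P.eval a)) := by
  rw [sum_sq_mul_coeff_mul_pow (natDegree_rowPoly_le hj hP)]
  obtain ⟨g, hg⟩ : ∃ g : ℝ[X], g = (1 + X ^ 2 : ℝ[X]) ^ j * X ^ (K - j) := ⟨_, rfl⟩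
  have hf : rowPoly K P j = g * P := by rw [rowPoly, hg]
  have hode := mul_derivative_one_add_sq_pow_mul_pow hj
  rw [← hg] at hode
  have h1 := congrArg (eval a) hode
  have h2 := congrArg (fun p => eval a (derivative p)) hode
  have hy : 1 + a ^ 2 ≠ 0 := by positivity
  have hx : a + a⁻¹ = (1 + a ^ 2) / a := by field_simp; ring
  have hx0 : a + a⁻¹ ≠ 0 := by rw [hx]; exact div_ne_zero hy ha
  have hg0 : g.eval a = a ^ K * (a + a⁻¹) ^ j := by
    have := eval_rowPoly hj (1 : ℝ[X]) ha
    rw [rowPoly, ← hg] at this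
    simpa using this
  simp only [derivative_mul, derivative_add, derivative_pow, derivative_one, derivative_X,
    derivative_C, eval_mul, eval_add, eval_pow, eval_X, eval_one, eval_C, eval_zero] at h1 h2
  have e1 : (j : ℝ) * (a + a⁻¹) ^ (j - 1) = j * (a + a⁻¹) ^ j / (a + a⁻¹) := by
    rcases j with _ | j
    · simp
    · rw [Nat.add_sub_cancel, pow_succ]; field_simp
  have e2 : ((j : ℝ) * (j - 1)) * (a + a⁻¹) ^ (j - 2) =
      (j : ℝ) * (j - 1) * (a + a⁻¹) ^ j / (a + a⁻¹) ^ 2 := by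
    rcases j with _ | _ | j
    · simp
    · simp
    · rw [show j + 1 + 1 - 2 = j by omega, eq_div_iff (pow_ne_zero 2 hx0), mul_assoc, ← pow_add]
  rw [e1, mul_assoc 4, e2, hf]
  simp only [derivative_mul, derivative_add, eval_mul, eval_add]
  have g1 : eval a (derivative g) = ((K + j) * a ^ 2 + (K - j)) / ((1 + a ^ 2) * a) * g.eval a := by
    rw [div_mul_eq_mul_div, eq_div_iff (mul_ne_zero hy ha)]
    linear_combination h1
  have g2 : eval a (derivative (derivative g)) = (2 * (K + j) * a * g.eval a +
      ((K + j) * a ^ 2 + (K - j)) * eval a (derivative g) -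
        (1 + 3 * a ^ 2) * eval a (derivative g)) / ((1 + a ^ 2) * a) := by
    rw [eq_div_iff (mul_ne_zero hy ha)]
    linear_combination h2
  have g3 : ∀ t : ℝ, a ^ K * t = g.eval a * (t / (a + a⁻¹) ^ j) := by
    intro t
    rw [hg0]
    field_simp
  rw [g3, g2, g1, hx]
  have hxj : ((1 + a ^ 2) / a) ^ j ≠ 0 := by rw [← hx]; exact pow_ne_zero _ hx0
  generalize ((1 + a ^ 2) / a) ^ j = z at hxj
  generalize eval a g = g0
  push_cast
  field_simp
  ring

end RowPolynomials

section MinorExpansion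

open Polynomial

/-- The minor of the coefficient matrix of the row polynomials given by the exponents `n`. -/
noncomputable def coeffMinor {R : Type*} [CommRing R] (K : ℕ) (P : R[X])
    (n : Fin (K + 1) → ℕ) : R :=
  (Matrix.of fun i j : Fin (K + 1) => (rowPoly K P j).coeff (n i)).det

lemma sum_coeffMinor_weighted {R : Type*} [CommRing R] {K M : ℕ} (P : R[X])
    (ω : Fin (K + 1) → Fin M → R) :
    ∑ n : Fin (K + 1) → Fin M, (∏ i, ω i (n i)) * coeffMinor K P (fun i => n i) =
      (Matrix.of fun i j : Fin (K + 1) => ∑ n : Fin M, ω i n * (rowPoly K P j).coeff n).det :=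
  (det_of_sum_smul ω fun (n : Fin M) (j : Fin (K + 1)) => (rowPoly K P j).coeff n).symm

lemma sum_coeffMinor {F : Type*} [Field F] {K N : ℕ} {P : F[X]} (hP : P.natDegree ≤ N)
    {a : Fin (K + 1) → F} (ha : ∀ i, a i ≠ 0) :
    ∑ n : Fin (K + 1) → Fin (N + 2 * K + 1), (∏ i, a i ^ (n i : ℕ)) *
      coeffMinor K P (fun i => n i) =
    (∏ i, (a i ^ K * P.eval (a i))) * (Matrix.vandermonde fun i => a i + (a i)⁻¹).det := by
  rw [sum_coeffMinor_weighted P fun i n => a i ^ (n : ℕ), ← Matrix.det_mul_column]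
  congr 1
  ext i j
  have hj : (j : ℕ) ≤ K := Nat.lt_succ_iff.1 j.2
  have h := eval_rowPoly hj P (ha i)
  rw [eval_eq_sum_range' (Nat.lt_succ_iff.2 (natDegree_rowPoly_le hj hP))] at h
  simp only [Matrix.of_apply, Matrix.vandermonde_apply]
  rw [Fin.sum_univ_eq_sum_range fun n => a i ^ n * (rowPoly K P j).coeff n]
  simp only [mul_comm (a i ^ _) ((rowPoly K P j).coeff _)]
  rw [h]
  ring

lemma sum_sum_erase_comm {ι M : Type*} [Fintype ι] [DecidableEq ι] [AddCommMonoid M]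
    (f : ι → ι → M) :
    ∑ i, ∑ j ∈ Finset.univ.erase i, f i j = ∑ i, ∑ j ∈ Finset.univ.erase i, f j i := by
  refine Finset.sum_comm' fun i j => ?_
  simp [eq_comm]

lemma trace_diff_eq {N : ℕ} {a b : ℝ} {u : Matrix (Fin N) (Fin N) ℝ} (hu : u * uᵀ = 1)
    (ha0 : a ≠ 0) (hb0 : b ≠ 0) (ha : (1 - a • u).det ≠ 0) (hb : (1 - b • u).det ≠ 0)
    (hab : a ≠ b) (hab' : 1 - a * b ≠ 0) :
    (resolventPart a u * (resolventPart b u)ᵀ).trace -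
        (resolventPart a u * resolventPart b u).trace =
      1 / 2 * ((a - a⁻¹) * (-2 * (resolventPart a u).trace - N) *
          (a + a⁻¹ - (b + b⁻¹))⁻¹ +
        (b - b⁻¹) * (-2 * (resolventPart b u).trace - N) * (b + b⁻¹ - (a + a⁻¹))⁻¹) -
      N / 2 := by
  rw [trace_resolventPart_mul ha hb hab, trace_resolventPart_mul_transpose hu ha hb hab']
  have h0 : a - b ≠ 0 := sub_ne_zero.2 hab
  have h1 : a + a⁻¹ - (b + b⁻¹) = -((a - b) * (1 - a * b)) / (a * b) := by
    field_simp; ring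
  have h2 : b + b⁻¹ - (a + a⁻¹) = (a - b) * (1 - a * b) / (a * b) := by
    field_simp; ring
  rw [h1, h2, Fintype.card_fin]
  field_simp
  ring

lemma add_inv_ne {a b : ℝ} (ha : 0 < a) (ha1 : a < 1) (hb : 0 < b) (hb1 : b < 1) (hab : a ≠ b) :
    a + a⁻¹ ≠ b + b⁻¹ := by
  intro h
  have h1 : (a - b) * (1 - a * b) = 0 := by
    field_simp at h
    linear_combination -h
  rcases mul_eq_zero.1 h1 with h2 | h2
  · exact hab (sub_eq_zero.1 h2)
  · nlinarith

/-- The generating function of the minors weighted by the Casimir eigenvalues. -/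
lemma sum_coeffMinor_casimir {K N : ℕ} {u : Matrix (Fin N) (Fin N) ℝ} (hu : u * uᵀ = 1)
    (hu' : uᵀ * u = 1) {a : Fin (K + 1) → ℝ} (ha0 : ∀ i, 0 < a i) (ha1 : ∀ i, a i < 1)
    (hinj : Function.Injective a) :
    ∑ n : Fin (K + 1) → Fin (N + 2 * K + 1), (∏ i, a i ^ (n i : ℕ)) *
      ((∑ i, ((n i : ℝ) - ((N + 2 * K : ℕ) : ℝ) / 2) ^ 2 -
          ∑ j : Fin (K + 1), ((N : ℝ) / 2 + j) ^ 2) *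
        coeffMinor K u.charpolyRev (fun i => n i)) =
    (∏ i, a i ^ K) * (Matrix.vandermonde fun i => a i + (a i)⁻¹).det *
      ((∏ i, (1 - a i • u).det) * loopTerm a u) := by
  set P := u.charpolyRev with hPdef
  have hP : P.natDegree ≤ N := by
    rw [hPdef, ← Matrix.reverse_charpoly]
    refine (reverse_natDegree_le _).trans ?_
    rw [Matrix.charpoly_natDegree_eq_dim, Fintype.card_fin]
  have habs : ∀ i, |a i| < 1 := fun i => by rw [abs_of_pos (ha0 i)]; exact ha1 i
  have hdet : ∀ i, (1 - a i • u).det ≠ 0 := fun i => det_one_sub_smul_ne_zero (habs i) hu'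
  have hne : ∀ i, a i ≠ 0 := fun i => (ha0 i).ne'
  have hx : Function.Injective fun i => a i + (a i)⁻¹ := by
    intro i j hij
    by_contra h
    exact add_inv_ne (ha0 i) (ha1 i) (ha0 j) (ha1 j) (fun h' => h (hinj h')) hij
  set x : Fin (K + 1) → ℝ := fun i => a i + (a i)⁻¹ with hxdef
  set δ := (Matrix.vandermonde x).det with hδ
  set T : Fin (K + 1) → ℝ := fun i => (resolventPart (a i) u).trace with hT
  set S : Fin (K + 1) → ℝ := fun i => ((N : ℝ) - 1) * T i + T i ^ 2 -
      (resolventPart (a i) u * resolventPart (a i) u).trace with hS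
  set c : Fin (K + 1) → ℝ := fun i => a i ^ K * (1 - a i • u).det with hc
  set lam : Fin (K + 1) → ℝ := fun i => (a i - (a i)⁻¹) * (-2 * T i - N) with hlam
  have hrow : ∀ i j : Fin (K + 1),
      ∑ n : Fin (N + 2 * K + 1), ((n : ℝ) - ((N + 2 * K : ℕ) : ℝ) / 2) ^ 2 * a i ^ (n : ℕ) *
        (rowPoly K P j).coeff n = c i *
        (((j : ℝ) ^ 2 * x i ^ (j : ℕ) - 4 * ((j : ℝ) * (j - 1)) * x i ^ ((j : ℕ) - 2)) +
          lam i * ((j : ℝ) * x i ^ ((j : ℕ) - 1)) +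
          (S i + (N : ℝ) ^ 2 / 4) * x i ^ (j : ℕ)) := by
    intro i j
    rw [euler_rowPoly (Nat.lt_succ_iff.1 j.2) hP (hne i), hPdef,
      eval_second_derivative_charpolyRev (hdet i), eval_derivative_charpolyRev (hdet i),
      eval_charpolyRev_eq_det]
    simp only [hc, hlam, hS, hT, hxdef]
    ring
  have hterm : ∀ l : Fin (K + 1), ∑ n : Fin (K + 1) → Fin (N + 2 * K + 1),
      (∏ i, a i ^ (n i : ℕ)) * (((n l : ℝ) - ((N + 2 * K : ℕ) : ℝ) / 2) ^ 2 *
        coeffMinor K P (fun i => n i)) =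
      (∏ i, c i) * (((Matrix.vandermonde x).updateRow l fun j : Fin (K + 1) =>
        (j : ℝ) ^ 2 * x l ^ (j : ℕ) - 4 * ((j : ℝ) * (j - 1)) * x l ^ ((j : ℕ) - 2)).det +
        lam l * ((∑ j ∈ Finset.univ.erase l, (x l - x j)⁻¹) * δ) +
        (S l + (N : ℝ) ^ 2 / 4) * δ) := by
    intro l
    have h1 := sum_coeffMinor_weighted P fun (i : Fin (K + 1)) (n : Fin (N + 2 * K + 1)) =>
      (if i = l then ((n : ℝ) - ((N + 2 * K : ℕ) : ℝ) / 2) ^ 2 else 1) * a i ^ (n : ℕ)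
    simp only [Finset.prod_mul_distrib, Finset.prod_ite_eq', Finset.mem_univ, if_true] at h1
    refine Eq.trans (Finset.sum_congr rfl fun n _ => by ring) (h1.trans ?_)
    have h2 : ((Matrix.vandermonde x).updateRow l fun j : Fin (K + 1) =>
        ((j : ℝ) ^ 2 * x l ^ (j : ℕ) - 4 * ((j : ℝ) * (j - 1)) * x l ^ ((j : ℕ) - 2)) +
          lam l * ((j : ℝ) * x l ^ ((j : ℕ) - 1)) +
          (S l + (N : ℝ) ^ 2 / 4) * x l ^ (j : ℕ)).det =
        ((Matrix.vandermonde x).updateRow l fun j : Fin (K + 1) =>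
        (j : ℝ) ^ 2 * x l ^ (j : ℕ) - 4 * ((j : ℝ) * (j - 1)) * x l ^ ((j : ℕ) - 2)).det +
        lam l * ((∑ j ∈ Finset.univ.erase l, (x l - x j)⁻¹) * δ) +
        (S l + (N : ℝ) ^ 2 / 4) * δ := by
      have h3 : ((Matrix.vandermonde x).updateRow l fun j : Fin (K + 1) =>
          x l ^ (j : ℕ)).det = δ := by
        congr 1
        exact Matrix.updateRow_eq_self _ _
      rw [← det_updateRow_vandermonde_derivative hx, ← h3]
      rw [← Matrix.det_updateRow_smul,
        ← Matrix.det_updateRow_smul, ← Matrix.det_updateRow_add, ← Matrix.det_updateRow_add]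
      rfl
    rw [← h2, ← Matrix.det_mul_column]
    congr 1
    ext i j
    simp only [Matrix.of_apply]
    by_cases hil : i = l
    · subst hil
      simp only [if_true, Matrix.updateRow_self]
      exact hrow i j
    · simp only [hil, if_false, one_mul, ne_eq, not_false_eq_true, Matrix.updateRow_ne]
      have hj : (j : ℕ) ≤ K := Nat.lt_succ_iff.1 j.2
      have h := eval_rowPoly hj P (hne i)
      rw [eval_eq_sum_range' (Nat.lt_succ_iff.2 (natDegree_rowPoly_le hj hP)), hPdef,
        eval_charpolyRev_eq_det] at h
      rw [Fin.sum_univ_eq_sum_range fun n => a i ^ n * (rowPoly K P j).coeff n]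
      simp only [mul_comm (a i ^ _) ((rowPoly K P j).coeff _)]
      rw [h, Matrix.vandermonde_apply]
      ring
  have hpair : ∑ i, lam i * ((∑ j ∈ Finset.univ.erase i, (x i - x j)⁻¹) * δ) =
      (∑ i, ∑ j ∈ Finset.univ.erase i, ((resolventPart (a i) u * (resolventPart (a j) u)ᵀ).trace -
        (resolventPart (a i) u * resolventPart (a j) u).trace) +
      (N : ℝ) / 2 * ((K + 1) * K)) * δ := by
    have h1 : ∑ i, ∑ j ∈ Finset.univ.erase i,
        ((resolventPart (a i) u * (resolventPart (a j) u)ᵀ).trace -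
        (resolventPart (a i) u * resolventPart (a j) u).trace) =
        ∑ i, ∑ j ∈ Finset.univ.erase i, (1 / 2 * (lam i * (x i - x j)⁻¹) +
          1 / 2 * (lam j * (x j - x i)⁻¹) - N / 2) := by
      refine Finset.sum_congr rfl fun i _ => Finset.sum_congr rfl fun j hj => ?_
      have hij : i ≠ j := (Finset.ne_of_mem_erase hj).symm
      rw [trace_diff_eq hu (hne i) (hne j) (hdet i) (hdet j) (fun h => hij (hinj h))
        (by nlinarith [ha0 i, ha1 i, ha0 j, ha1 j])]
      ring
    have h2 := sum_sum_erase_comm fun i j => 1 / 2 * (lam i * (x i - x j)⁻¹)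
    have h3 : ∑ i : Fin (K + 1), ∑ j ∈ Finset.univ.erase i, (N : ℝ) / 2 =
        (N : ℝ) / 2 * ((K + 1) * K) := by
      simp [Finset.card_erase_of_mem]
      ring
    have h4 : ∑ i, lam i * ((∑ j ∈ Finset.univ.erase i, (x i - x j)⁻¹) * δ) =
        (∑ i, ∑ j ∈ Finset.univ.erase i, lam i * (x i - x j)⁻¹) * δ := by
      simp only [Finset.sum_mul, Finset.mul_sum, mul_assoc]
    have h5 : ∑ i, ∑ j ∈ Finset.univ.erase i, 1 / 2 * (lam i * (x i - x j)⁻¹) =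
        1 / 2 * ∑ i, ∑ j ∈ Finset.univ.erase i, lam i * (x i - x j)⁻¹ := by
      simp only [Finset.mul_sum]
    rw [h1, h4]
    simp only [Finset.sum_add_distrib, Finset.sum_sub_distrib]
    rw [← h2, h3, h5]
    ring
  have hE : ∑ j : Fin (K + 1), ((N : ℝ) / 2 + j) ^ 2 = ∑ j : Fin (K + 1), (j : ℝ) ^ 2 +
      (K + 1) * ((N : ℝ) ^ 2 / 4) + (N : ℝ) / 2 * ((K + 1) * K) := by
    have h1 : (∑ j : Fin (K + 1), (j : ℝ)) * 2 = (K + 1) * K := by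
      rw [Fin.sum_univ_eq_sum_range (fun n => (n : ℝ)) (K + 1)]
      have := Finset.sum_range_id_mul_two (K + 1)
      rw [Nat.add_sub_cancel] at this
      have h2 := congrArg (Nat.cast : ℕ → ℝ) this
      push_cast at h2
      exact h2
    simp only [add_sq, Finset.sum_add_distrib, ← Finset.mul_sum, Finset.sum_const,
      Finset.card_univ, Fintype.card_fin, nsmul_eq_mul]
    push_cast
    linear_combination (N : ℝ) / 2 * h1
  have h0 : ∑ n : Fin (K + 1) → Fin (N + 2 * K + 1),
      (∏ i, a i ^ (n i : ℕ)) * coeffMinor K P (fun i => n i) = (∏ i, c i) * δ := by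
    rw [sum_coeffMinor hP hne, hPdef]
    simp only [eval_charpolyRev_eq_det]
    rfl
  calc _ = ∑ l, ∑ n : Fin (K + 1) → Fin (N + 2 * K + 1),
      (∏ i, a i ^ (n i : ℕ)) * (((n l : ℝ) - ((N + 2 * K : ℕ) : ℝ) / 2) ^ 2 *
        coeffMinor K P (fun i => n i)) - (∑ j : Fin (K + 1), ((N : ℝ) / 2 + j) ^ 2) *
        ∑ n : Fin (K + 1) → Fin (N + 2 * K + 1),
      (∏ i, a i ^ (n i : ℕ)) * coeffMinor K P (fun i => n i) := by
        rw [Finset.sum_comm, Finset.mul_sum, ← Finset.sum_sub_distrib]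
        refine Finset.sum_congr rfl fun n _ => ?_
        rw [← Finset.mul_sum, ← Finset.sum_mul]
        ring
    _ = _ := by
        rw [Finset.sum_congr rfl fun l _ => hterm l, h0, ← Finset.mul_sum]
        simp only [Finset.sum_add_distrib]
        rw [hpair, sum_det_updateRow_vandermonde_euler, hE]
        have hprod : ∏ i, c i = (∏ i, a i ^ K) * ∏ i, (1 - a i • u).det := by
          rw [← Finset.prod_mul_distrib]
        rw [hprod, loopTerm]
        simp only [← Finset.sum_mul, Finset.sum_add_distrib, Finset.sum_const, Finset.card_univ,
          Fintype.card_fin, nsmul_eq_mul]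
        push_cast
        simp only [hS, hT]
        ring

end MinorExpansion

section Vanishing

open Polynomial

variable {N : ℕ}

lemma natDegree_charpolyRev_le {R : Type*} [CommRing R] (u : Matrix (Fin N) (Fin N) R) :
    u.charpolyRev.natDegree ≤ N := by
  nontriviality R
  rw [← Matrix.reverse_charpoly]
  refine (reverse_natDegree_le _).trans ?_
  rw [Matrix.charpoly_natDegree_eq_dim, Fintype.card_fin]

lemma continuous_coeff_charpolyRev (n : ℕ) :
    Continuous fun u : Matrix (Fin N) (Fin N) ℝ => u.charpolyRev.coeff n := by
  have h : ∀ u : Matrix (Fin N) (Fin N) ℝ, u.charpolyRev.coeff n =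
      MvPolynomial.eval (fun p : Fin N × Fin N => u p.1 p.2)
        ((Matrix.charpoly.univ ℝ (Fin N)).coeff (revAt N n)) := by
    intro u
    rw [← Matrix.reverse_charpoly, coeff_reverse, Matrix.charpoly_natDegree_eq_dim,
      Fintype.card_fin]
    have h1 := Matrix.charpoly.univ_coeff_eval₂Hom (Fin N) (RingHom.id ℝ)
      (fun p : Fin N × Fin N => u p.1 p.2) (revAt N n)
    have h2 : Matrix.of (Function.curry fun p : Fin N × Fin N => u p.1 p.2) = u := rfl
    rw [h2] at h1
    rw [← h1, MvPolynomial.eval]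
  simp only [h]
  refine (MvPolynomial.continuous_eval _).comp ?_
  fun_prop

lemma continuous_coeffMinor_charpolyRev (K : ℕ) (n : Fin (K + 1) → ℕ) :
    Continuous fun u : Matrix (Fin N) (Fin N) ℝ => coeffMinor K u.charpolyRev n := by
  refine Continuous.matrix_det (continuous_matrix fun i j => ?_)
  simp only [Matrix.of_apply, rowPoly, coeff_mul]
  refine continuous_finsetSum _ fun p _ => continuous_const.mul (continuous_coeff_charpolyRev _)

variable (μ : Measure (Matrix.orthogonalGroup (Fin N) ℝ)) [IsFiniteMeasure μ]

lemma integrable_mul_coeffMinor (K : ℕ) (n : Fin (K + 1) → ℕ) :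
    Integrable (fun u : Matrix.orthogonalGroup (Fin N) ℝ =>
      (1 - (u : Matrix (Fin N) (Fin N) ℝ).det) *
        coeffMinor K (u : Matrix (Fin N) (Fin N) ℝ).charpolyRev n) μ :=
  integrable_of_continuous_of_compact
    ((continuous_const.sub continuous_subtype_val.matrix_det).mul
      ((continuous_coeffMinor_charpolyRev K n).comp continuous_subtype_val))

/-- The averaged minors are supported on the exponents with the extremal Casimir eigenvalue. -/
lemma casimir_mul_integral_coeffMinor_eq_zero [μ.IsMulLeftInvariant] {K : ℕ}
    (n : Fin (K + 1) → Fin (N + 2 * K + 1)) :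
    (∑ i, ((n i : ℝ) - ((N + 2 * K : ℕ) : ℝ) / 2) ^ 2 -
        ∑ j : Fin (K + 1), ((N : ℝ) / 2 + j) ^ 2) *
      ∫ u : Matrix.orthogonalGroup (Fin N) ℝ, (1 - (u : Matrix (Fin N) (Fin N) ℝ).det) *
        coeffMinor K (u : Matrix (Fin N) (Fin N) ℝ).charpolyRev (fun i => n i) ∂μ = 0 := by
  have hK : (0 : ℝ) < (K : ℝ) + 1 := by positivity
  refine eq_zero_of_sum_mul_prod_pow_eq_zero
    (S := fun i : Fin (K + 1) => Set.Ioo ((i : ℝ) / (K + 1)) (((i : ℝ) + 1) / (K + 1)))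
    (fun i => Set.Ioo_infinite (by gcongr; linarith))
    (c := fun n => (∑ i, ((n i : ℝ) - ((N + 2 * K : ℕ) : ℝ) / 2) ^ 2 -
        ∑ j : Fin (K + 1), ((N : ℝ) / 2 + j) ^ 2) *
      ∫ u : Matrix.orthogonalGroup (Fin N) ℝ, (1 - (u : Matrix (Fin N) (Fin N) ℝ).det) *
        coeffMinor K (u : Matrix (Fin N) (Fin N) ℝ).charpolyRev (fun i => n i) ∂μ)
    (fun a ha => ?_) n
  have ha' : ∀ i : Fin (K + 1), (i : ℝ) < a i * (K + 1) ∧ a i * (K + 1) < i + 1 := fun i =>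
    ⟨(div_lt_iff₀ hK).1 (ha i).1, (lt_div_iff₀ hK).1 (ha i).2⟩
  have ha0 : ∀ i, 0 < a i := fun i => lt_of_le_of_lt (by positivity) (ha i).1
  have ha1 : ∀ i, a i < 1 := fun i => by
    refine (ha i).2.trans_le ((div_le_one hK).2 ?_)
    have h : ((i : ℕ) : ℝ) ≤ K := by exact_mod_cast Nat.lt_succ_iff.1 i.2
    linarith
  have hinj : Function.Injective a := by
    intro i j hij
    have h1 := ha' i
    have h2 := ha' j
    rw [hij] at h1
    have h3 : ((i : ℕ) : ℝ) < (j : ℕ) + 1 := h1.1.trans h2.2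
    have h4 : ((j : ℕ) : ℝ) < (i : ℕ) + 1 := h2.1.trans h1.2
    have h5 : (i : ℕ) < j + 1 := by exact_mod_cast h3
    have h6 : (j : ℕ) < i + 1 := by exact_mod_cast h4
    exact Fin.ext (by omega)
  have key := integral_loopTerm_eq_zero (N := N) μ (a := a)
    (fun i => by rw [abs_of_pos (ha0 i)]; exact ha1 i)
  have h1 : ∀ u : Matrix.orthogonalGroup (Fin N) ℝ,
      (∏ i, a i ^ K) * (Matrix.vandermonde fun i => a i + (a i)⁻¹).det *
        ((1 - (u : Matrix (Fin N) (Fin N) ℝ).det) *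
      ((∏ i, (1 - a i • (u : Matrix (Fin N) (Fin N) ℝ)).det) *
        loopTerm a (u : Matrix (Fin N) (Fin N) ℝ))) =
      ∑ n : Fin (K + 1) → Fin (N + 2 * K + 1), (∏ i, a i ^ (n i : ℕ)) *
        ((∑ i, ((n i : ℝ) - ((N + 2 * K : ℕ) : ℝ) / 2) ^ 2 -
          ∑ j : Fin (K + 1), ((N : ℝ) / 2 + j) ^ 2) *
        ((1 - (u : Matrix (Fin N) (Fin N) ℝ).det) *
          coeffMinor K (u : Matrix (Fin N) (Fin N) ℝ).charpolyRev (fun i => n i))) := by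
    intro u
    have h := sum_coeffMinor_casimir (K := K) ((Matrix.mem_orthogonalGroup_iff _ _).1 u.2)
      ((Matrix.mem_orthogonalGroup_iff' _ _).1 u.2) ha0 ha1 hinj
    rw [mul_left_comm, ← h, Finset.mul_sum]
    refine Finset.sum_congr rfl fun n _ => by ring
  have h2 := congrArg (fun t => (∏ i, a i ^ K) *
    (Matrix.vandermonde fun i => a i + (a i)⁻¹).det * t) key
  simp only [mul_zero] at h2
  rw [← integral_const_mul] at h2
  simp only [h1] at h2
  rw [integral_finsetSum _ fun n _ =>
    ((integrable_mul_coeffMinor μ K _).const_mul _).const_mul _] at h2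
  simpa only [integral_const_mul] using h2

end Vanishing

section Palindromic

open Polynomial

variable {N : ℕ}

lemma charpolyRev_eq_charpoly_of_det_neg_one {u : Matrix (Fin N) (Fin N) ℝ} (hN : Odd N)
    (hu : u * uᵀ = 1) (hdet : u.det = -1) : u.charpolyRev = u.charpoly := by
  refine Polynomial.funext fun a => ?_
  rw [eval_charpolyRev_eq_det, Matrix.eval_charpoly]
  have h1 : 1 - a • u = u * (-((Matrix.scalar (Fin N) a) - uᵀ)) := by
    rw [neg_sub, mul_sub, hu, Matrix.scalar_apply, ← Matrix.smul_one_eq_diagonal]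
    simp
  have h2 : Matrix.scalar (Fin N) a - uᵀ = (Matrix.scalar (Fin N) a - u)ᵀ := by
    simp
  rw [h1, Matrix.det_mul, Matrix.det_neg, hdet, h2, Matrix.det_transpose, Fintype.card_fin,
    hN.neg_one_pow]
  ring

lemma reflect_charpolyRev_of_det_neg_one {u : Matrix (Fin N) (Fin N) ℝ} (hN : Odd N)
    (hu : u * uᵀ = 1) (hdet : u.det = -1) : u.charpolyRev.reflect N = u.charpolyRev := by
  conv_rhs => rw [← Matrix.reverse_charpoly, reverse, Matrix.charpoly_natDegree_eq_dim,
    Fintype.card_fin, ← charpolyRev_eq_charpoly_of_det_neg_one hN hu hdet]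

lemma reflect_rowPoly {K j : ℕ} (hj : j ≤ K) {P : ℝ[X]} (hP : P.natDegree ≤ N)
    (hr : P.reflect N = P) : (rowPoly K P j).reflect (N + 2 * K) = rowPoly K P j := by
  have h1 : ((1 + X ^ 2 : ℝ[X])).natDegree ≤ 2 := by compute_degree
  have h2 : (1 + X ^ 2 : ℝ[X]).reflect 2 = 1 + X ^ 2 := by
    have h : (1 : ℝ[X]) = X ^ 0 := (pow_zero _).symm
    rw [reflect_add, h, reflect_monomial, reflect_monomial]
    simp [revAt_le, add_comm]
  have h3 : ∀ j : ℕ, ((1 + X ^ 2 : ℝ[X]) ^ j).reflect (2 * j) = (1 + X ^ 2) ^ j := by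
    intro j
    induction j with
    | zero =>
      have h : (1 : ℝ[X]) = X ^ 0 := (pow_zero _).symm
      rw [pow_zero, h, reflect_monomial]
      simp [revAt_le]
    | succ j ih =>
      rw [pow_succ, mul_add_one,
        reflect_mul _ _ ((natDegree_pow_le_of_le j h1).trans (by omega)) h1, ih, h2]
  have h4 : ((X : ℝ[X]) ^ (K - j)).reflect (2 * (K - j)) = X ^ (K - j) := by
    rw [reflect_monomial, revAt_le (by omega)]
    congr 1
    omega
  have h5 : ((1 + X ^ 2 : ℝ[X]) ^ j).natDegree ≤ 2 * j :=
    (natDegree_pow_le_of_le j h1).trans (by omega)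
  have h6 : ((X : ℝ[X]) ^ (K - j)).natDegree ≤ 2 * (K - j) :=
    (natDegree_X_pow_le _).trans (by omega)
  have h7 : N + 2 * K = 2 * j + 2 * (K - j) + N := by omega
  rw [rowPoly, h7, reflect_mul _ _ (natDegree_mul_le_of_le h5 h6) hP,
    reflect_mul _ _ h5 h6, h3, h4, hr]

lemma coeff_rowPoly_min {K j n : ℕ} (hj : j ≤ K) {P : ℝ[X]} (hP : P.natDegree ≤ N)
    (hr : P.reflect N = P) (hn : n ≤ N + 2 * K) :
    (rowPoly K P j).coeff (min n (N + 2 * K - n)) = (rowPoly K P j).coeff n := by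
  rcases min_choice n (N + 2 * K - n) with h | h
  · rw [h]
  · rw [h]
    conv_rhs => rw [← reflect_rowPoly hj hP hr, coeff_reflect, revAt_le hn]

end Palindromic

section Uniqueness

open Polynomial

/-- Among sets of `K + 1` naturals in the left half of `[0, M]`, the initial segment is the only
one that is at least as spread out around `M / 2`. -/
lemma le_of_sum_sq_sub_ge {K M : ℕ} {d : Fin (K + 1) → ℕ} (hd : Function.Injective d)
    (hM : ∀ i, 2 * d i ≤ M)
    (hsum : ∑ j : Fin (K + 1), ((M : ℝ) / 2 - j) ^ 2 ≤ ∑ i, ((M : ℝ) / 2 - d i) ^ 2)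
    (i : Fin (K + 1)) : d i ≤ K := by
  by_contra! hi
  set f : ℕ → ℝ := fun x => ((M : ℝ) / 2 - x) ^ 2 with hf
  set D : Finset ℕ := Finset.univ.image d with hD
  set R : Finset ℕ := Finset.range (K + 1) with hR
  have hDcard : D.card = K + 1 := by
    rw [hD, Finset.card_image_of_injective _ hd, Finset.card_univ, Fintype.card_fin]
  have hcard : (R \ D).card = (D \ R).card := by
    rw [Finset.card_sdiff, Finset.card_sdiff, Finset.inter_comm, hDcard, hR, Finset.card_range]
  have hKM : 2 * (K : ℝ) ≤ M := by
    have := hM i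
    exact_mod_cast (show 2 * K ≤ M by omega)
  have hDR : ∀ x ∈ D \ R, f x < f K := by
    intro x hx
    obtain ⟨hx1, hx2⟩ := Finset.mem_sdiff.1 hx
    obtain ⟨l, -, rfl⟩ := Finset.mem_image.1 hx1
    have h1 : K < d l := by
      rw [hR, Finset.mem_range] at hx2
      omega
    have h1' : (K : ℝ) < d l := by exact_mod_cast h1
    have h2 : 2 * (d l : ℝ) ≤ M := by exact_mod_cast hM l
    simp only [hf]
    nlinarith
  have hRD : ∀ x ∈ R \ D, f K ≤ f x := by
    intro x hx
    have h1 := Finset.mem_range.1 (Finset.mem_sdiff.1 hx).1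
    have h2 : (x : ℝ) ≤ K := by exact_mod_cast Nat.lt_succ_iff.1 h1
    simp only [hf]
    nlinarith
  have hne : (D \ R).Nonempty :=
    ⟨d i, Finset.mem_sdiff.2 ⟨Finset.mem_image_of_mem _ (Finset.mem_univ i), by
      rw [hR, Finset.mem_range]; omega⟩⟩
  have h1 : ∑ x ∈ D \ R, f x < ∑ x ∈ D \ R, f K :=
    Finset.sum_lt_sum_of_nonempty hne hDR
  have h2 : ∑ x ∈ R \ D, f K ≤ ∑ x ∈ R \ D, f x := Finset.sum_le_sum hRD
  have h3 : ∑ x ∈ D, f x = ∑ i, f (d i) := Finset.sum_image fun a _ b _ h => hd h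
  have h4 : ∑ x ∈ R, f x = ∑ j : Fin (K + 1), f j := (Fin.sum_univ_eq_sum_range f _).symm
  have h5 := Finset.sum_inter_add_sum_sdiff D R f
  have h6 := Finset.sum_inter_add_sum_sdiff R D f
  rw [Finset.inter_comm] at h6
  rw [Finset.sum_const] at h1 h2
  rw [hcard] at h2
  linarith

lemma exists_perm_of_le {K : ℕ} {d : Fin (K + 1) → ℕ} (hd : Function.Injective d)
    (hle : ∀ i, d i ≤ K) : ∃ σ : Equiv.Perm (Fin (K + 1)), ∀ i, d i = σ i := by
  have hinj : Function.Injective fun i => (⟨d i, Nat.lt_succ_of_le (hle i)⟩ : Fin (K + 1)) :=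
    fun i j h => hd (Fin.mk.inj_iff.1 h)
  exact ⟨Equiv.ofBijective _ (Finite.injective_iff_bijective.1 hinj), fun i => rfl⟩

lemma eq_mul_det_of_alternating {K : ℕ} {d : Fin (K + 1) → ℕ}
    {F : (Fin (K + 1) → ℕ) → ℝ}
    (hF0 : (¬ ∃ σ : Equiv.Perm (Fin (K + 1)), ∀ i, d i = σ i) → F d = 0)
    (hFσ : ∀ σ : Equiv.Perm (Fin (K + 1)),
      F (fun i => σ i) = (Equiv.Perm.sign σ : ℝ) * F (fun i => i)) :
    F d = F (fun i => i) * (Matrix.of fun i j : Fin (K + 1) =>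
      if d i = j then (1 : ℝ) else 0).det := by
  by_cases h : ∃ σ : Equiv.Perm (Fin (K + 1)), ∀ i, d i = σ i
  · obtain ⟨σ, hσ⟩ := h
    have h1 : d = fun i => (σ i : ℕ) := funext hσ
    have h2 : (Matrix.of fun i j : Fin (K + 1) => if d i = j then (1 : ℝ) else 0) =
        (1 : Matrix (Fin (K + 1)) (Fin (K + 1)) ℝ).submatrix σ id := by
      ext i j
      simp [hσ, Matrix.one_apply, Fin.ext_iff]
    rw [h2, Matrix.det_permute, h1, hFσ, Matrix.det_one]
    ring
  · rw [hF0 h]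
    by_cases hle : ∀ i, d i ≤ K
    · have hninj : ¬ Function.Injective d := fun hd => h (exists_perm_of_le hd hle)
      simp only [Function.Injective, not_forall] at hninj
      obtain ⟨i, j, hij, hne⟩ := hninj
      rw [Matrix.det_zero_of_row_eq hne (by ext l; simp [hij]), mul_zero]
    · push Not at hle
      obtain ⟨i, hi⟩ := hle
      rw [Matrix.det_eq_zero_of_row_eq_zero i fun j => ?_, mul_zero]
      have := j.2
      rw [Matrix.of_apply, if_neg (by omega)]

variable {N : ℕ}

lemma det_eq_one_or_neg_one_of_orthogonal (u : Matrix.orthogonalGroup (Fin N) ℝ) :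
    (u : Matrix (Fin N) (Fin N) ℝ).det = 1 ∨ (u : Matrix (Fin N) (Fin N) ℝ).det = -1 := by
  have h := congrArg Matrix.det ((Matrix.mem_orthogonalGroup_iff _ _).1 u.2)
  rw [Matrix.det_mul, Matrix.det_transpose, Matrix.det_one] at h
  exact mul_self_eq_one_iff.1 h

variable (μ : Measure (Matrix.orthogonalGroup (Fin N) ℝ))

/-- The average of the coefficient minors over the matrices of determinant `-1`. -/
noncomputable def meanMinor (K : ℕ) (n : Fin (K + 1) → ℕ) : ℝ :=
  ∫ u : Matrix.orthogonalGroup (Fin N) ℝ, (1 - (u : Matrix (Fin N) (Fin N) ℝ).det) *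
    coeffMinor K (u : Matrix (Fin N) (Fin N) ℝ).charpolyRev n ∂μ

lemma meanMinor_min (hN : Odd N) {K : ℕ} {n : Fin (K + 1) → ℕ} (hn : ∀ i, n i ≤ N + 2 * K) :
    meanMinor μ K (fun i => min (n i) (N + 2 * K - n i)) = meanMinor μ K n := by
  refine integral_congr_ae (Filter.Eventually.of_forall fun u => ?_)
  rcases det_eq_one_or_neg_one_of_orthogonal u with h | h
  · simp [h]
  · simp only [coeffMinor]
    congr 3
    ext i j
    exact coeff_rowPoly_min (Nat.lt_succ_iff.1 j.2) (natDegree_charpolyRev_le _)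
      (reflect_charpolyRev_of_det_neg_one hN ((Matrix.mem_orthogonalGroup_iff _ _).1 u.2) h)
      (hn i)

lemma meanMinor_perm (K : ℕ) (σ : Equiv.Perm (Fin (K + 1))) :
    meanMinor μ K (fun i => σ i) = (Equiv.Perm.sign σ : ℝ) * meanMinor μ K (fun i => i) := by
  rw [meanMinor, meanMinor, ← integral_const_mul]
  refine integral_congr_ae (Filter.Eventually.of_forall fun u => ?_)
  have h := Matrix.det_permute σ (Matrix.of fun i j : Fin (K + 1) =>
    (rowPoly K (u : Matrix (Fin N) (Fin N) ℝ).charpolyRev j).coeff i)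
  simp only [coeffMinor]
  rw [mul_left_comm]
  congr 1

lemma meanMinor_eq [IsFiniteMeasure μ] [μ.IsMulLeftInvariant] (hN : Odd N) {K : ℕ}
    (n : Fin (K + 1) → Fin (N + 2 * K + 1)) :
    meanMinor μ K (fun i => n i) = meanMinor μ K (fun i => i) *
      (Matrix.of fun i j : Fin (K + 1) =>
        if min (n i : ℕ) (N + 2 * K - n i) = j then (1 : ℝ) else 0).det := by
  have hn : ∀ i, (n i : ℕ) ≤ N + 2 * K := fun i => Nat.lt_succ_iff.1 (n i).2
  rw [← meanMinor_min μ hN hn]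
  refine eq_mul_det_of_alternating (F := meanMinor μ K) (fun hσ => ?_) (meanMinor_perm μ K)
  set d : Fin (K + 1) → ℕ := fun i => min (n i : ℕ) (N + 2 * K - n i) with hd
  by_cases hinj : Function.Injective d
  · have h1 := casimir_mul_integral_coeffMinor_eq_zero μ n
    rcases mul_eq_zero.1 h1 with h2 | h2
    · refine absurd (exists_perm_of_le hinj (le_of_sum_sq_sub_ge (M := N + 2 * K) hinj
        (fun i => by simp only [hd]; omega) (le_of_eq ?_))) hσ
      have h3 : ∑ i, (((N + 2 * K : ℕ) : ℝ) / 2 - d i) ^ 2 =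
          ∑ i, ((n i : ℝ) - ((N + 2 * K : ℕ) : ℝ) / 2) ^ 2 := by
        refine Finset.sum_congr rfl fun i _ => ?_
        simp only [hd]
        rcases min_choice (n i : ℕ) (N + 2 * K - n i) with h | h
        · rw [h]; ring
        · rw [h, Nat.cast_sub (hn i)]; ring
      have h4 : ∑ j : Fin (K + 1), (((N + 2 * K : ℕ) : ℝ) / 2 - j) ^ 2 =
          ∑ j : Fin (K + 1), ((N : ℝ) / 2 + j) ^ 2 := by
        rw [← Equiv.sum_comp Fin.revPerm]
        refine Finset.sum_congr rfl fun j _ => ?_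
        have hj : (j : ℕ) ≤ K := Nat.lt_succ_iff.1 j.2
        rw [Fin.revPerm_apply, Fin.val_rev, Nat.add_sub_add_right, Nat.cast_sub hj]
        push_cast
        ring
      rw [h3, h4]
      linarith
    · rw [meanMinor_min μ hN hn]
      exact h2
  · simp only [Function.Injective, not_forall] at hinj
    obtain ⟨i, j, hij, hne⟩ := hinj
    rw [meanMinor]
    refine integral_eq_zero_of_ae (Filter.Eventually.of_forall fun u => ?_)
    have h : coeffMinor K (u : Matrix (Fin N) (Fin N) ℝ).charpolyRev d = 0 :=
      Matrix.det_zero_of_row_eq hne (by ext l; simp [hij])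
    simp [h]

lemma charpolyRev_map {R S : Type*} [CommRing R] [CommRing S] (f : R →+* S)
    (u : Matrix (Fin N) (Fin N) R) : (u.map f).charpolyRev = u.charpolyRev.map f := by
  rw [Matrix.charpolyRev, Matrix.charpolyRev, ← coe_mapRingHom, RingHom.map_det]
  congr 1
  ext i j
  simp [Matrix.one_apply, apply_ite (Polynomial.map f)]

lemma coeffMinor_map {R S : Type*} [CommRing R] [CommRing S] (f : R →+* S) (K : ℕ) (P : R[X])
    (n : Fin (K + 1) → ℕ) : coeffMinor K (P.map f) n = f (coeffMinor K P n) := by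
  rw [coeffMinor, coeffMinor, RingHom.map_det]
  congr 1
  ext i j
  have h : rowPoly K (P.map f) j = (rowPoly K P j).map f := by simp [rowPoly]
  simp [h]

/-- The average of `∏ det (1 - a i u)` over the matrices of determinant `-1`. -/
noncomputable def cosetMean {k : ℕ} (a : Fin k → ℂ) : ℂ :=
  ∫ u : Matrix.orthogonalGroup (Fin N) ℝ, ((1 - (u : Matrix (Fin N) (Fin N) ℝ).det : ℝ) : ℂ) *
    ∏ i, (1 - a i • toC u).det ∂μ

lemma cosetMean_mul_vandermonde [IsFiniteMeasure μ] [μ.IsMulLeftInvariant] (hN : Odd N) {K : ℕ}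
    {a : Fin (K + 1) → ℂ} (ha : ∀ i, a i ≠ 0) :
    (∏ i, a i ^ K) * (Matrix.vandermonde fun i => a i + (a i)⁻¹).det * cosetMean μ a =
      (meanMinor μ K (fun i => i) : ℂ) *
        (Matrix.of fun i j : Fin (K + 1) => a i ^ (j : ℕ) + a i ^ (N + 2 * K - j)).det := by
  have h1 : ∀ u : Matrix.orthogonalGroup (Fin N) ℝ,
      (∏ i, a i ^ K) * (Matrix.vandermonde fun i => a i + (a i)⁻¹).det *
        (((1 - (u : Matrix (Fin N) (Fin N) ℝ).det : ℝ) : ℂ) * ∏ i, (1 - a i • toC u).det) =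
      ∑ n : Fin (K + 1) → Fin (N + 2 * K + 1), (∏ i, a i ^ (n i : ℕ)) *
        (((1 - (u : Matrix (Fin N) (Fin N) ℝ).det) *
          coeffMinor K (u : Matrix (Fin N) (Fin N) ℝ).charpolyRev (fun i => n i) : ℝ) : ℂ) := by
    intro u
    have h := sum_coeffMinor (natDegree_charpolyRev_le (toC u)) ha
    have h2 : (toC u).charpolyRev =
        (u : Matrix (Fin N) (Fin N) ℝ).charpolyRev.map Complex.ofRealHom :=
      charpolyRev_map Complex.ofRealHom _
    simp only [eval_charpolyRev_eq_det, Finset.prod_mul_distrib] at h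
    rw [h2] at h
    simp only [coeffMinor_map, Complex.ofRealHom_eq_coe] at h
    calc _ = ((1 - (u : Matrix (Fin N) (Fin N) ℝ).det : ℝ) : ℂ) *
          ((∏ i, a i ^ K) * (∏ i, (1 - a i • toC u).det) *
            (Matrix.vandermonde fun i => a i + (a i)⁻¹).det) := by ring
      _ = _ := by
        rw [← h, Finset.mul_sum]
        refine Finset.sum_congr rfl fun n _ => ?_
        push_cast
        ring
  rw [cosetMean, ← integral_const_mul]
  simp only [h1]
  rw [integral_finsetSum _ fun n _ => (integrable_mul_coeffMinor μ K _).ofReal.const_mul _]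
  simp only [integral_const_mul, integral_complex_ofReal]
  have h3 : ∀ n : Fin (K + 1) → Fin (N + 2 * K + 1),
      ((∫ u : Matrix.orthogonalGroup (Fin N) ℝ, (1 - (u : Matrix (Fin N) (Fin N) ℝ).det) *
        coeffMinor K (u : Matrix (Fin N) (Fin N) ℝ).charpolyRev (fun i => n i) ∂μ : ℝ) : ℂ) =
      (meanMinor μ K (fun i => i) : ℂ) * (Matrix.of fun i j : Fin (K + 1) =>
        if min (n i : ℕ) (N + 2 * K - n i) = j then (1 : ℂ) else 0).det := by
    intro n
    have h := congrArg Complex.ofRealHom (meanMinor_eq μ hN n)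
    rw [map_mul, RingHom.map_det] at h
    refine h.trans ?_
    rw [Complex.ofRealHom_eq_coe]
    congr 2
    ext i j
    simp
  have h4 := det_of_sum_smul (fun (i : Fin (K + 1)) (n : Fin (N + 2 * K + 1)) => a i ^ (n : ℕ))
    fun (n : Fin (N + 2 * K + 1)) (j : Fin (K + 1)) =>
      if min (n : ℕ) (N + 2 * K - n) = j then (1 : ℂ) else 0
  have h5 : (Matrix.of fun i j : Fin (K + 1) => a i ^ (j : ℕ) + a i ^ (N + 2 * K - j)) =
      Matrix.of fun i j : Fin (K + 1) => ∑ n : Fin (N + 2 * K + 1), a i ^ (n : ℕ) *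
        if min (n : ℕ) (N + 2 * K - n) = j then (1 : ℂ) else 0 := by
    ext i j
    have hj := j.2
    have hN' := hN.pos
    obtain ⟨l, hl⟩ := hN
    simp only [Matrix.of_apply, mul_ite, mul_one, mul_zero]
    rw [Fin.sum_univ_eq_sum_range (fun n => if min n (N + 2 * K - n) = j then a i ^ n else 0),
      ← Finset.sum_filter]
    have h6 : (Finset.range (N + 2 * K + 1)).filter (fun n => min n (N + 2 * K - n) = j) =
        {(j : ℕ), N + 2 * K - j} := by
      ext n
      simp only [Finset.mem_filter, Finset.mem_range, Finset.mem_insert, Finset.mem_singleton]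
      omega
    rw [h6, Finset.sum_pair (by omega)]
  rw [h5, h4, Finset.mul_sum]
  refine Finset.sum_congr rfl fun n _ => ?_
  have h6 := h3 n
  refine (congrArg (fun t => (∏ i, a i ^ (n i : ℕ)) * t) h6).trans ?_
  ring

end Uniqueness

section HalfChebyshev

open Polynomial

/-- The monic polynomials with `2 cos ((ν + 1/2) θ) = 2 cos (θ / 2) p_ν (2 cos θ)`. -/
noncomputable def halfCheb : ℕ → ℂ[X]
  | 0 => 1
  | 1 => X - 1
  | ν + 2 => X * halfCheb (ν + 1) - halfCheb ν

lemma halfCheb_monic_natDegree (ν : ℕ) :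
    ((halfCheb ν).Monic ∧ (halfCheb ν).natDegree = ν) ∧
      (halfCheb (ν + 1)).Monic ∧ (halfCheb (ν + 1)).natDegree = ν + 1 := by
  induction ν with
  | zero =>
    refine ⟨⟨monic_one, natDegree_one⟩, ?_⟩
    have h : halfCheb (0 + 1) = X - C 1 := by rw [C_1]; rfl
    rw [h]
    exact ⟨monic_X_sub_C 1, natDegree_X_sub_C 1⟩
  | succ ν ih =>
    obtain ⟨⟨h1, h2⟩, h3, h4⟩ := ih
    refine ⟨⟨h3, h4⟩, ?_⟩
    have h5 : (X * halfCheb (ν + 1)).Monic := monic_X.mul h3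
    have h6 : (X * halfCheb (ν + 1)).natDegree = ν + 2 := by
      rw [monic_X.natDegree_mul h3, natDegree_X, h4]; ring
    have h7 : (halfCheb ν).degree < (X * halfCheb (ν + 1)).degree := by
      rw [degree_eq_natDegree h1.ne_zero, degree_eq_natDegree h5.ne_zero, h2, h6]
      exact_mod_cast (by omega)
    have h8 : halfCheb (ν + 1 + 1) = X * halfCheb (ν + 1) - halfCheb ν := rfl
    rw [h8]
    refine ⟨h5.sub_of_left h7, ?_⟩
    rw [natDegree_sub_eq_left_of_natDegree_lt (by omega), h6]

lemma halfCheb_monic (ν : ℕ) : (halfCheb ν).Monic := (halfCheb_monic_natDegree ν).1.1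

lemma natDegree_halfCheb (ν : ℕ) : (halfCheb ν).natDegree = ν := (halfCheb_monic_natDegree ν).1.2

lemma eval_halfCheb_add_inv {z : ℂ} (hz : z ≠ 0) (ν : ℕ) :
    (1 + z) * z ^ ν * (halfCheb ν).eval (z + z⁻¹) = 1 + z ^ (2 * ν + 1) := by
  induction ν using Nat.strongRec with
  | _ ν ih =>
    match ν with
    | 0 => simp [halfCheb]
    | 1 =>
      simp only [halfCheb, eval_sub, eval_X, eval_one]
      field_simp
      ring
    | ν + 2 =>
      have h1 := ih (ν + 1) (by omega)
      have h2 := ih ν (by omega)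
      have h3 : (halfCheb (ν + 2)).eval (z + z⁻¹) =
          (z + z⁻¹) * (halfCheb (ν + 1)).eval (z + z⁻¹) - (halfCheb ν).eval (z + z⁻¹) := by
        simp [halfCheb]
      have h4 : z * z⁻¹ = 1 := mul_inv_cancel₀ hz
      rw [h3]
      linear_combination (z ^ 2 + 1) * h1 - z ^ 2 * h2 +
        (1 + z) * z ^ (ν + 1) * (halfCheb (ν + 1)).eval (z + z⁻¹) * h4

end HalfChebyshev

section Christoffel

open Polynomial

lemma det_functional_monic {n : ℕ} {ι : Type*} [Fintype ι] [DecidableEq ι]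
    (Λ : ι → ℂ[X] →ₗ[ℂ] ℂ) (e : ι ≃ Fin n) {P : Fin n → ℂ[X]}
    (hP : ∀ i, (P i).natDegree = i) (hm : ∀ i, (P i).Monic) :
    (Matrix.of fun r s => Λ r (P (e s))).det =
      (Matrix.of fun r s => Λ r (X ^ (e s : ℕ))).det := by
  have h1 : (Matrix.of fun r s => Λ r (P (e s))) =
      (Matrix.of fun r s => Λ r (X ^ (e s : ℕ))) *
        (Matrix.of fun i j : Fin n => (P j).coeff i).submatrix e e := by
    ext r s
    have h2 : P (e s) = ∑ t : Fin n, (P (e s)).coeff t • X ^ (t : ℕ) := by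
      rw [Fin.sum_univ_eq_sum_range fun t => (P (e s)).coeff t • (X : ℂ[X]) ^ t]
      conv_lhs => rw [(P (e s)).as_sum_range' n (by rw [hP]; exact (e s).2)]
      refine Finset.sum_congr rfl fun t _ => ?_
      rw [smul_X_eq_monomial]
    simp only [Matrix.of_apply, Matrix.mul_apply, Matrix.submatrix_apply]
    conv_lhs => rw [h2]
    rw [map_sum, ← Equiv.sum_comp e]
    refine Finset.sum_congr rfl fun t _ => ?_
    rw [map_smul, smul_eq_mul, mul_comm]
  rw [h1, Matrix.det_mul, Matrix.det_submatrix_equiv_self,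
    Matrix.det_matrixOfPolynomials P hP hm, mul_one]

/-- The Christoffel formula for modifying an orthonormality functional by `∏ (X - x i)`. -/
lemma exists_christoffel (m k : ℕ) : ∃ ε : ℂ, ∀ (L : ℂ[X] →ₗ[ℂ] ℂ),
    (∀ j l, L (halfCheb j * halfCheb l) = if j = l then 1 else 0) → ∀ x : Fin k → ℂ,
    (Matrix.of fun i j : Fin k => (halfCheb (m + j)).eval (x i)).det =
      ε * (Matrix.vandermonde x).det *
        (Matrix.of fun j l : Fin m =>
          L ((∏ i, (X - C (x i))) * halfCheb j * halfCheb l)).det := by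
  let eA : Fin m ⊕ Fin k ≃ Fin (m + k) := finSumFinEquiv
  let eB : Fin m ⊕ Fin k ≃ Fin (m + k) :=
    ((Equiv.sumComm _ _).trans finSumFinEquiv).trans (finCongr (add_comm k m))
  refine ⟨(Equiv.Perm.sign (eA.trans eB.symm) : ℂ), fun L hL x => ?_⟩
  let Q : ℂ[X] := ∏ i, (X - C (x i))
  have hQm : Q.Monic := monic_prod_of_monic _ _ fun i _ => monic_X_sub_C _
  have hQd : Q.natDegree = k := by
    simp only [Q]
    rw [natDegree_prod_of_monic _ _ fun i _ => monic_X_sub_C _]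
    simp
  have hQx : ∀ i, Q.eval (x i) = 0 := fun i => by
    simp only [Q, eval_prod]
    exact Finset.prod_eq_zero (Finset.mem_univ i) (by simp)
  let Λ : Fin m ⊕ Fin k → ℂ[X] →ₗ[ℂ] ℂ :=
    Sum.elim (fun j => L ∘ₗ LinearMap.mulLeft ℂ (halfCheb j)) fun i => Polynomial.leval (x i)
  let PB : Fin (m + k) → ℂ[X] := fun i =>
    if (i : ℕ) < k then X ^ (i : ℕ) else Q * halfCheb (i - k)
  have hA := det_functional_monic Λ eA (P := fun i => halfCheb i)
    (fun i => natDegree_halfCheb i) fun i => halfCheb_monic i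
  have hB := det_functional_monic Λ eB (P := PB)
    (fun i => by
      simp only [PB]
      split_ifs with h
      · exact natDegree_X_pow _
      · rw [hQm.natDegree_mul (halfCheb_monic _), hQd, natDegree_halfCheb]; omega)
    (fun i => by
      simp only [PB]
      split_ifs with h
      · exact monic_X_pow _
      · exact hQm.mul (halfCheb_monic _))
  have hperm : (Matrix.of fun r s => Λ r (X ^ (eA s : ℕ))).det =
      (Equiv.Perm.sign (eA.trans eB.symm) : ℂ) *
        (Matrix.of fun r s => Λ r (X ^ (eB s : ℕ))).det := by
    rw [← Matrix.det_permute']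
    congr 1
    ext r s
    simp
  have hA' : (Matrix.of fun r s => Λ r (halfCheb (eA s))) =
      Matrix.fromBlocks 1 0 (Matrix.of fun (i : Fin k) (j : Fin m) => (halfCheb j).eval (x i))
        (Matrix.of fun i j : Fin k => (halfCheb (m + j)).eval (x i)) := by
    ext r s
    rcases r with r | r <;> rcases s with s | s
    · simp [Λ, eA, hL, Matrix.one_apply, Fin.ext_iff]
    · have : (r : ℕ) ≠ m + s := by omega
      simp [Λ, eA, hL, this]
    · simp [Λ, eA]
    · simp [Λ, eA]
  have hB' : (Matrix.of fun r s => Λ r (PB (eB s))) =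
      Matrix.fromBlocks (Matrix.of fun j l : Fin m => L (Q * halfCheb j * halfCheb l))
        (Matrix.of fun (j : Fin m) (l : Fin k) => L (halfCheb j * X ^ (l : ℕ))) 0
        (Matrix.vandermonde x) := by
    ext r s
    rcases r with r | r <;> rcases s with s | s
    · simp [Λ, eB, PB]
      congr 1
      ring
    · simp [Λ, eB, PB]
    · simp [Λ, eB, PB, hQx]
    · simp [Λ, eB, PB, Matrix.vandermonde_apply]
  rw [hA', Matrix.det_fromBlocks_zero₁₂, Matrix.det_one, one_mul] at hA
  rw [hB', Matrix.det_fromBlocks_zero₂₁] at hB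
  rw [hA, hperm, ← hB]
  ring

end Christoffel

section Fourier

open Polynomial

lemma fCoeff_eq_zpow (f : ℝ → ℂ) (n : ℤ) :
    fCoeff f n = ((2 * Real.pi : ℝ) : ℂ)⁻¹ *
      ∫ θ in (0 : ℝ)..(2 * Real.pi), f θ * Complex.exp (Complex.I * θ) ^ (-n) := by
  rw [fCoeff]
  congr 1
  refine intervalIntegral.integral_congr fun θ _ => ?_
  rw [← Complex.exp_int_mul]
  congr 2
  push_cast
  ring

lemma fCoeff_const_mul (c : ℂ) (f : ℝ → ℂ) (n : ℤ) :
    fCoeff (fun θ => c * f θ) n = c * fCoeff f n := by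
  simp only [fCoeff, mul_assoc, intervalIntegral.integral_const_mul]
  ring

lemma continuous_fourier_factor (n : ℤ) :
    Continuous fun θ : ℝ => Complex.exp (Complex.I * θ) ^ n :=
  Continuous.zpow₀ (by fun_prop) n fun θ => Or.inl (Complex.exp_ne_zero _)

lemma intervalIntegrable_mul_fourier_factor {f : ℝ → ℂ} (hf : Continuous f) (n : ℤ) :
    IntervalIntegrable (fun θ : ℝ => f θ * Complex.exp (Complex.I * θ) ^ n)
      volume 0 (2 * Real.pi) :=
  (hf.mul (continuous_fourier_factor n)).intervalIntegrable _ _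

lemma fCoeff_add {f g : ℝ → ℂ} (hf : Continuous f) (hg : Continuous g) (n : ℤ) :
    fCoeff (fun θ => f θ + g θ) n = fCoeff f n + fCoeff g n := by
  simp only [fCoeff_eq_zpow, add_mul]
  rw [intervalIntegral.integral_add
    (intervalIntegrable_mul_fourier_factor hf _) (intervalIntegrable_mul_fourier_factor hg _)]
  ring

lemma fCoeff_one (n : ℤ) : fCoeff (fun _ => 1) n = if n = 0 then 1 else 0 := by
  have hpi : ((2 * Real.pi : ℝ) : ℂ) ≠ 0 := by
    exact_mod_cast Real.two_pi_pos.ne'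
  split_ifs with h
  · simp only [fCoeff, h, Int.cast_zero, neg_zero, zero_mul, Complex.exp_zero, mul_one]
    rw [intervalIntegral.integral_const, sub_zero, Complex.real_smul, mul_one,
      inv_mul_cancel₀ hpi]
  · have hc : -(n : ℂ) * Complex.I ≠ 0 :=
      mul_ne_zero (neg_ne_zero.2 (by exact_mod_cast h)) Complex.I_ne_zero
    simp only [fCoeff, one_mul]
    rw [integral_exp_mul_complex hc]
    have h1 : -(n : ℂ) * Complex.I * ((2 * Real.pi : ℝ) : ℂ) =
        ((-n : ℤ) : ℂ) * (2 * Real.pi * Complex.I) := by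
      push_cast
      ring
    rw [h1, Complex.exp_int_mul_two_pi_mul_I]
    simp

/-- The function `θ ↦ f (2 cos θ)`. -/
noncomputable def cosEval (f : ℂ[X]) (θ : ℝ) : ℂ :=
  f.eval (Complex.exp (Complex.I * θ) + (Complex.exp (Complex.I * θ))⁻¹)

lemma continuous_cosEval (f : ℂ[X]) : Continuous (cosEval f) := by
  refine f.continuous.comp (Continuous.add (by fun_prop) (Continuous.inv₀ (by fun_prop) ?_))
  exact fun θ => Complex.exp_ne_zero _

lemma exp_two_pi_sub (θ : ℝ) : Complex.exp (Complex.I * ((2 * Real.pi - θ : ℝ) : ℂ)) =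
    (Complex.exp (Complex.I * θ))⁻¹ := by
  rw [← Complex.exp_neg, ← Complex.exp_periodic.sub_eq' ]
  congr 1
  push_cast
  ring

lemma fCoeff_cosEval (f : ℂ[X]) (n : ℤ) :
    fCoeff (cosEval f) n = ((2 * Real.pi : ℝ) : ℂ)⁻¹ *
      ∫ θ in (0 : ℝ)..(2 * Real.pi), cosEval f θ *
        ((Complex.exp (Complex.I * θ) ^ n + Complex.exp (Complex.I * θ) ^ (-n)) / 2) := by
  have h1 : fCoeff (cosEval f) n = ((2 * Real.pi : ℝ) : ℂ)⁻¹ *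
      ∫ θ in (0 : ℝ)..(2 * Real.pi), cosEval f θ * Complex.exp (Complex.I * θ) ^ n := by
    have h := intervalIntegral.integral_comp_sub_left (a := 0) (b := 2 * Real.pi)
      (fun θ : ℝ => cosEval f θ * Complex.exp (Complex.I * θ) ^ (-n)) (2 * Real.pi)
    rw [sub_self, sub_zero] at h
    rw [fCoeff_eq_zpow, ← h]
    congr 1
    refine intervalIntegral.integral_congr fun θ _ => ?_
    simp only [cosEval, exp_two_pi_sub, inv_inv, _root_.inv_zpow, _root_.zpow_neg]
    rw [add_comm]
  have h2 := fCoeff_eq_zpow (cosEval f) n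
  have h3 : ∀ θ : ℝ, cosEval f θ *
      ((Complex.exp (Complex.I * θ) ^ n + Complex.exp (Complex.I * θ) ^ (-n)) / 2) =
      (1 / 2) * (cosEval f θ * Complex.exp (Complex.I * θ) ^ n +
        cosEval f θ * Complex.exp (Complex.I * θ) ^ (-n)) := fun θ => by ring
  simp only [h3]
  rw [intervalIntegral.integral_const_mul, intervalIntegral.integral_add
    (intervalIntegrable_mul_fourier_factor (continuous_cosEval f) _)
    (intervalIntegrable_mul_fourier_factor (continuous_cosEval f) _)]
  linear_combination (1 / 2) * h1 + (1 / 2) * h2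

/-- The functional making the half-angle Chebyshev polynomials orthonormal. -/
noncomputable def halfChebFunctional : ℂ[X] →ₗ[ℂ] ℂ where
  toFun f := fCoeff (cosEval f) 0 + fCoeff (cosEval f) 1
  map_add' f g := by
    have h : cosEval (f + g) = fun θ => cosEval f θ + cosEval g θ := by
      ext θ; simp [cosEval]
    rw [h, fCoeff_add (continuous_cosEval f) (continuous_cosEval g),
      fCoeff_add (continuous_cosEval f) (continuous_cosEval g)]
    ring
  map_smul' c f := by
    have h : cosEval (c • f) = fun θ => c * cosEval f θ := by
      ext θ; simp [cosEval]
    rw [h, fCoeff_const_mul, fCoeff_const_mul, RingHom.id_apply, smul_eq_mul]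
    ring

lemma halfCheb_product_formula {z : ℂ} (hz : z ≠ 0) (j l : ℕ) :
    (halfCheb j).eval (z + z⁻¹) * (halfCheb l).eval (z + z⁻¹) * (2 + z + z⁻¹) =
      z ^ ((j : ℤ) - l) + z ^ (-((j : ℤ) - l)) + z ^ ((j : ℤ) + l + 1) +
        z ^ (-((j : ℤ) + l + 1)) := by
  have h1 := eval_halfCheb_add_inv hz j
  have h2 := eval_halfCheb_add_inv (inv_ne_zero hz) l
  rw [inv_inv, add_comm z⁻¹ z] at h2
  set p := (halfCheb j).eval (z + z⁻¹)
  set q := (halfCheb l).eval (z + z⁻¹)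
  have h3 := congrArg₂ (· * ·) h1 h2
  have h4 : z ^ j * z⁻¹ ^ l ≠ 0 := mul_ne_zero (pow_ne_zero _ hz) (pow_ne_zero _ (inv_ne_zero hz))
  refine mul_left_cancel₀ h4 ?_
  have h5 : z * z⁻¹ = 1 := mul_inv_cancel₀ hz
  have h6 : z ^ j * z⁻¹ ^ l * (p * q * (2 + z + z⁻¹)) =
      (1 + z ^ (2 * j + 1)) * (1 + z⁻¹ ^ (2 * l + 1)) := by
    rw [← h3]
    linear_combination (-(z ^ j * z⁻¹ ^ l * p * q)) * h5
  rw [h6]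
  simp only [neg_sub, neg_add_rev, zpow_add₀ hz, zpow_sub₀ hz, zpow_natCast,
    _root_.zpow_neg, zpow_one, inv_pow]
  field_simp
  ring

lemma halfChebFunctional_mul (f : ℂ[X]) (j l : ℕ) :
    halfChebFunctional (f * halfCheb j * halfCheb l) =
      fCoeff (cosEval f) ((j : ℤ) - l) + fCoeff (cosEval f) ((j : ℤ) + l + 1) := by
  have hc : ∀ (g : ℂ[X]) (n : ℤ), IntervalIntegrable (fun θ : ℝ => cosEval g θ *
      ((Complex.exp (Complex.I * θ) ^ n + Complex.exp (Complex.I * θ) ^ (-n)) / 2))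
      volume 0 (2 * Real.pi) := fun g n =>
    ((continuous_cosEval g).mul (((continuous_fourier_factor n).add
      (continuous_fourier_factor (-n))).div_const 2)).intervalIntegrable _ _
  change fCoeff _ 0 + fCoeff _ 1 = _
  simp only [fCoeff_cosEval]
  rw [← mul_add, ← mul_add, ← intervalIntegral.integral_add (hc _ _) (hc _ _),
    ← intervalIntegral.integral_add (hc _ _) (hc _ _)]
  congr 1
  refine intervalIntegral.integral_congr fun θ _ => ?_
  have h := halfCheb_product_formula (Complex.exp_ne_zero (Complex.I * θ)) j l
  simp only [cosEval, eval_mul, neg_zero, zpow_zero, zpow_one, _root_.zpow_neg_one]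
  linear_combination
    (1 / 2) * f.eval (Complex.exp (Complex.I * θ) + (Complex.exp (Complex.I * θ))⁻¹) * h

lemma halfChebFunctional_orthonormal (j l : ℕ) :
    halfChebFunctional (halfCheb j * halfCheb l) = if j = l then 1 else 0 := by
  have h := halfChebFunctional_mul 1 j l
  have h1 : cosEval 1 = fun _ => 1 := by ext θ; simp [cosEval]
  rw [one_mul, h1, fCoeff_one, fCoeff_one,
    if_neg (by omega : ¬ (j : ℤ) + l + 1 = 0), add_zero] at h
  rw [h]
  simp [sub_eq_zero]

lemma phiGG_eq_cosEval {k : ℕ} {a : Fin k → ℂ} (ha : ∀ i, a i ≠ 0) :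
    phiGG a = fun θ => (∏ i, -a i) * cosEval (∏ i, (X - C (a i + (a i)⁻¹))) θ := by
  ext θ
  simp only [phiGG, cosEval, eval_prod, eval_sub, eval_X, eval_C, ← Finset.prod_mul_distrib]
  refine Finset.prod_congr rfl fun i _ => ?_
  rw [neg_mul, Complex.exp_neg]
  have h1 := Complex.exp_ne_zero (Complex.I * θ)
  have h2 := ha i
  field_simp
  ring

/-- The Toeplitz plus Hankel side of the identity. -/
noncomputable def toeplitzHankel (m : ℕ) {k : ℕ} (a : Fin k → ℂ) : ℂ :=
  (∏ i : Fin k, (1 + a i)) *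
    (Matrix.of fun j k' : Fin m =>
      fCoeff (phiGG a) (((j : ℕ) : ℤ) - ((k' : ℕ) : ℤ)) +
        fCoeff (phiGG a) (((j : ℕ) : ℤ) + ((k' : ℕ) : ℤ) + 1)).det

lemma toeplitzHankel_eq (m : ℕ) {k : ℕ} {a : Fin k → ℂ} (ha : ∀ i, a i ≠ 0) :
    toeplitzHankel m a = (∏ i, (1 + a i)) * ((∏ i, -a i) ^ m *
      (Matrix.of fun j l : Fin m => halfChebFunctional
        ((∏ i, (X - C (a i + (a i)⁻¹))) * halfCheb j * halfCheb l)).det) := by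
  have h := Matrix.det_smul (Matrix.of fun j l : Fin m => halfChebFunctional
        ((∏ i, (X - C (a i + (a i)⁻¹))) * halfCheb j * halfCheb l)) (∏ i, -a i)
  rw [Fintype.card_fin] at h
  rw [toeplitzHankel, ← h]
  congr 2
  ext j l
  rw [phiGG_eq_cosEval ha, Matrix.of_apply, fCoeff_const_mul, fCoeff_const_mul, Matrix.smul_apply,
    Matrix.of_apply, halfChebFunctional_mul, smul_eq_mul, mul_add]

lemma toeplitzHankel_zero (m k : ℕ) : toeplitzHankel m (0 : Fin k → ℂ) = 1 := by
  have h : phiGG (0 : Fin k → ℂ) = fun _ => 1 := by ext θ; simp [phiGG]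
  have h1 : (Matrix.of fun j k' : Fin m =>
      fCoeff (phiGG (0 : Fin k → ℂ)) (((j : ℕ) : ℤ) - ((k' : ℕ) : ℤ)) +
        fCoeff (phiGG (0 : Fin k → ℂ)) (((j : ℕ) : ℤ) + ((k' : ℕ) : ℤ) + 1)) = 1 := by
    ext j l
    rw [h, Matrix.of_apply, fCoeff_one, fCoeff_one, if_neg (by omega : ¬ ((j : ℕ) : ℤ) + l + 1 = 0),
      add_zero, Matrix.one_apply]
    simp [sub_eq_zero, Fin.ext_iff]
  rw [toeplitzHankel, h1]
  simp

lemma continuous_toeplitzHankel (m k : ℕ) :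
    Continuous fun a : Fin k → ℂ => toeplitzHankel m a := by
  have h : ∀ n : ℤ, Continuous fun a : Fin k → ℂ => fCoeff (phiGG a) n := by
    intro n
    refine continuous_const.mul
      (intervalIntegral.continuous_parametric_intervalIntegral_of_continuous' ?_ _ _)
    simp only [phiGG, Function.uncurry_def]
    fun_prop
  refine Continuous.mul (by fun_prop) (Continuous.matrix_det (continuous_matrix fun j l => ?_))
  exact (h _).add (h _)

end Fourier

section Comparison

open Polynomial

variable {N : ℕ} (μ : Measure (Matrix.orthogonalGroup (Fin N) ℝ))

lemma integral_det_eq_zero (hN : Odd N) [μ.IsMulLeftInvariant] :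
    ∫ u : Matrix.orthogonalGroup (Fin N) ℝ, (u : Matrix (Fin N) (Fin N) ℝ).det ∂μ = 0 := by
  have hmem : (-1 : Matrix (Fin N) (Fin N) ℝ) ∈ Matrix.orthogonalGroup (Fin N) ℝ := by
    rw [Matrix.mem_orthogonalGroup_iff]
    simp
  have h := integral_mul_left_eq_self (μ := μ)
    (fun u : Matrix.orthogonalGroup (Fin N) ℝ => (u : Matrix (Fin N) (Fin N) ℝ).det) ⟨-1, hmem⟩
  have h1 : ∀ u : Matrix.orthogonalGroup (Fin N) ℝ,
      (((⟨-1, hmem⟩ * u : Matrix.orthogonalGroup (Fin N) ℝ)) : Matrix (Fin N) (Fin N) ℝ).det =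
        -(u : Matrix (Fin N) (Fin N) ℝ).det := by
    intro u
    rw [Submonoid.coe_mul, neg_one_mul, Matrix.det_neg, Fintype.card_fin, hN.neg_one_pow]
    ring
  simp only [h1, integral_neg] at h
  linarith

lemma cosetMean_zero (hN : Odd N) [IsProbabilityMeasure μ] [μ.IsMulLeftInvariant] (k : ℕ) :
    cosetMean μ (0 : Fin k → ℂ) = 1 := by
  have h : Integrable (fun u : Matrix.orthogonalGroup (Fin N) ℝ =>
      (u : Matrix (Fin N) (Fin N) ℝ).det) μ :=
    integrable_of_continuous_of_compact continuous_subtype_val.matrix_det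
  simp only [cosetMean, Pi.zero_apply, zero_smul, sub_zero, Matrix.det_one,
    Finset.prod_const_one, mul_one]
  rw [integral_complex_ofReal, integral_sub (integrable_const _) h, integral_det_eq_zero μ hN]
  simp

lemma continuous_cosetMean [IsFiniteMeasure μ] (k : ℕ) :
    Continuous fun a : Fin k → ℂ => cosetMean μ a := by
  have h : Continuous (Function.uncurry fun (a : Fin k → ℂ)
      (u : Matrix.orthogonalGroup (Fin N) ℝ) =>
      ((1 - (u : Matrix (Fin N) (Fin N) ℝ).det : ℝ) : ℂ) * ∏ i, (1 - a i • toC u).det) := by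
    have hC : Continuous fun u : Matrix.orthogonalGroup (Fin N) ℝ => toC u :=
      continuous_subtype_val.matrix_map Complex.continuous_ofReal
    refine Continuous.mul (Complex.continuous_ofReal.comp (continuous_const.sub
      (continuous_subtype_val.matrix_det.comp continuous_snd))) ?_
    refine continuous_finsetProd _ fun i _ => Continuous.matrix_det ?_
    exact continuous_const.sub (((continuous_apply i).comp continuous_fst).smul
      (hC.comp continuous_snd))
  have h1 := continuous_parametric_integral_of_continuous (μ := μ) h isCompact_univ
  simpa only [cosetMean, Measure.restrict_univ] using h1

lemma exists_det_pow_add_pow_eq (m K : ℕ) : ∃ ε : ℂ, ∀ a : Fin (K + 1) → ℂ, (∀ i, a i ≠ 0) →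
    (Matrix.of fun i j : Fin (K + 1) =>
      a i ^ (j : ℕ) + a i ^ (2 * m + 1 + 2 * K - j)).det =
    ε * ((∏ i, a i ^ K) * (Matrix.vandermonde fun i => a i + (a i)⁻¹).det *
      toeplitzHankel m a) := by
  obtain ⟨ε, hε⟩ := exists_christoffel m (K + 1)
  refine ⟨(Equiv.Perm.sign (Fin.revPerm (n := K + 1)) : ℂ) * ε * ((-1) ^ (K + 1)) ^ m,
    fun a ha => ?_⟩
  have h1 : (Matrix.of fun i j : Fin (K + 1) =>
      a i ^ (j : ℕ) + a i ^ (2 * m + 1 + 2 * K - j)).det =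
      (∏ i, ((1 + a i) * a i ^ (m + K))) * (Matrix.of fun i j : Fin (K + 1) =>
        (halfCheb (m + (Fin.revPerm j : Fin (K + 1)))).eval (a i + (a i)⁻¹)).det := by
    rw [← Matrix.det_mul_column]
    congr 1
    ext i j
    have hj : (j : ℕ) ≤ K := Nat.lt_succ_iff.1 j.2
    obtain ⟨ν, hν⟩ := Nat.exists_eq_add_of_le hj
    have h2 := eval_halfCheb_add_inv (ha i) (m + ν)
    have h3 : K + 1 - ((j : ℕ) + 1) = ν := by omega
    have h4 : 2 * m + 1 + 2 * K - j = j + (2 * (m + ν) + 1) := by omega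
    have h5 : m + K = j + (m + ν) := by omega
    simp only [Matrix.of_apply, Fin.revPerm_apply, Fin.val_rev]
    rw [h3, h4, h5, pow_add, pow_add (a i) j (m + ν)]
    linear_combination (-(a i ^ (j : ℕ))) * h2
  have h2 := Matrix.det_permute' (Fin.revPerm (n := K + 1)) (Matrix.of fun i j : Fin (K + 1) =>
        (halfCheb (m + j)).eval (a i + (a i)⁻¹))
  have h3 : (Matrix.of fun i j : Fin (K + 1) =>
        (halfCheb (m + (Fin.revPerm j : Fin (K + 1)))).eval (a i + (a i)⁻¹)) =
      (Matrix.of fun i j : Fin (K + 1) =>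
        (halfCheb (m + j)).eval (a i + (a i)⁻¹)).submatrix id Fin.revPerm := rfl
  have h4 : ((-1 : ℂ) ^ (K + 1)) ^ m * ((-1 : ℂ) ^ (K + 1)) ^ m = 1 := by
    rw [← mul_pow, ← mul_pow]
    simp
  rw [h1, h3, h2, hε halfChebFunctional halfChebFunctional_orthonormal, toeplitzHankel_eq m ha,
    Finset.prod_mul_distrib, Finset.prod_neg, Finset.card_univ, Fintype.card_fin]
  simp only [pow_add, Finset.prod_mul_distrib, Finset.prod_pow, mul_pow, pow_one] at h4 ⊢
  linear_combination (-((Equiv.Perm.sign (Fin.revPerm (n := K + 1)) : ℂ) * ε * (∏ i, (1 + a i)) *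
    (∏ i, a i) ^ m * (∏ i, a i) ^ K * (Matrix.vandermonde fun i => a i + (a i)⁻¹).det *
    (Matrix.of fun j l : Fin m => halfChebFunctional
        ((∏ i, (X - C (a i + (a i)⁻¹))) * halfCheb j * halfCheb l)).det)) * h4

/-- Every point is a limit, along a line, of points with nonzero coordinates and
distinct values of `a + a⁻¹`. -/
lemma exists_dense_generic {k : ℕ} (a : Fin k → ℂ) : ∃ S : Set ℂ, Dense S ∧ ∀ t ∈ S,
    (∀ i, a i + ((i : ℕ) + 1) * t ≠ 0) ∧ Function.Injective fun i : Fin k =>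
      (a i + ((i : ℕ) + 1) * t) + (a i + ((i : ℕ) + 1) * t)⁻¹ := by
  let q : Fin k → ℂ[X] := fun i => C (a i) + C (((i : ℕ) : ℂ) + 1) * X
  have hcoef : ∀ i : Fin k, ((i : ℕ) : ℂ) + 1 ≠ 0 := fun i => Nat.cast_add_one_ne_zero _
  have hq1 : ∀ i, (q i).coeff 1 = ((i : ℕ) : ℂ) + 1 := fun i => by simp [q]
  have hq : ∀ i, q i ≠ 0 := fun i h => hcoef i (by rw [← hq1, h, coeff_zero])
  have hqd : ∀ i j, i ≠ j → q i - q j ≠ 0 := by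
    intro i j hij h
    have h1 : (q i - q j).coeff 1 = 0 := by rw [h, coeff_zero]
    rw [coeff_sub, hq1, hq1, add_sub_add_right_eq_sub, sub_eq_zero] at h1
    exact hij (Fin.ext (by exact_mod_cast h1))
  have hqm : ∀ i j, 1 - q i * q j ≠ 0 := by
    intro i j h
    have hdeg : ∀ i, (q i).natDegree = 1 := fun i => by
      simp only [q]
      rw [add_comm]
      exact natDegree_linear (hcoef i)
    have h1 : (q i * q j).natDegree = 2 := by rw [natDegree_mul (hq i) (hq j), hdeg, hdeg]
    rw [← sub_eq_zero.1 h, natDegree_one] at h1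
    omega
  let p : ℂ[X] := (∏ i, q i) * ∏ i, ∏ j ∈ Finset.univ.erase i, ((q i - q j) * (1 - q i * q j))
  have hp : p ≠ 0 := by
    refine mul_ne_zero (Finset.prod_ne_zero_iff.2 fun i _ => hq i)
      (Finset.prod_ne_zero_iff.2 fun i _ => Finset.prod_ne_zero_iff.2 fun j hj => ?_)
    exact mul_ne_zero (hqd i j (Finset.ne_of_mem_erase hj).symm) (hqm i j)
  refine ⟨(p.rootSet ℂ)ᶜ, ((p.rootSet_finite ℂ).countable).dense_compl ℂ, fun t ht => ?_⟩
  have hpt : p.eval t ≠ 0 := by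
    intro h
    exact ht ((mem_rootSet.2 ⟨hp, by simpa using h⟩))
  have hev : ∀ i, (q i).eval t = a i + ((i : ℕ) + 1) * t := fun i => by simp [q]
  simp only [p, eval_mul, eval_prod, eval_sub, eval_one, hev, mul_ne_zero_iff,
    Finset.prod_ne_zero_iff] at hpt
  have h0 : ∀ i, a i + ((i : ℕ) + 1) * t ≠ 0 := fun i => hpt.1 i (Finset.mem_univ i)
  refine ⟨h0, fun i j hij => ?_⟩
  by_contra hne
  obtain ⟨h1, h2⟩ := hpt.2 i (Finset.mem_univ i) j
    (Finset.mem_erase.2 ⟨fun h => hne h.symm, Finset.mem_univ j⟩)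
  have hi := h0 i
  have hj := h0 j
  simp only at hij
  generalize a i + ((i : ℕ) + 1) * t = x at *
  generalize a j + ((j : ℕ) + 1) * t = y at *
  refine mul_ne_zero h1 h2 ?_
  field_simp at hij
  linear_combination -hij

lemma cosetMean_eq_toeplitzHankel (m : ℕ)
    (μ : Measure (Matrix.orthogonalGroup (Fin (2 * m + 1)) ℝ)) [IsProbabilityMeasure μ]
    [μ.IsMulLeftInvariant] {k : ℕ} (a : Fin k → ℂ) :
    cosetMean μ a = toeplitzHankel m a := by
  have hN : Odd (2 * m + 1) := odd_two_mul_add_one m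
  rcases k with _ | K
  · rw [Subsingleton.elim a 0, cosetMean_zero μ hN, toeplitzHankel_zero]
  obtain ⟨ε, hε⟩ := exists_det_pow_add_pow_eq m K
  set c : ℂ := (meanMinor μ K (fun i => i) : ℂ) * ε with hc
  have key : ∀ a : Fin (K + 1) → ℂ, cosetMean μ a = c * toeplitzHankel m a := by
    intro a
    obtain ⟨S, hS, hgen⟩ := exists_dense_generic a
    let b : ℂ → Fin (K + 1) → ℂ := fun t i => a i + ((i : ℕ) + 1) * t
    have hb : Continuous b := by
      refine continuous_pi fun i => ?_
      simp only [b]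
      fun_prop
    have hb0 : b 0 = a := by ext i; simp [b]
    have heq : (fun t => cosetMean μ (b t)) = fun t => c * toeplitzHankel m (b t) := by
      refine Continuous.ext_on hS ((continuous_cosetMean μ _).comp hb)
        (continuous_const.mul ((continuous_toeplitzHankel m _).comp hb)) fun t ht => ?_
      obtain ⟨h0, hinj⟩ := hgen t ht
      have h1 := cosetMean_mul_vandermonde μ hN (a := b t) h0
      rw [hε (b t) h0] at h1
      have h2 : (Matrix.vandermonde fun i => b t i + (b t i)⁻¹).det ≠ 0 :=
        Matrix.det_vandermonde_ne_zero_iff.2 hinj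
      have h3 : ∏ i, b t i ^ K ≠ 0 := Finset.prod_ne_zero_iff.2 fun i _ => pow_ne_zero _ (h0 i)
      refine mul_left_cancel₀ (mul_ne_zero h3 h2) ?_
      rw [h1, hc]
      ring
    have h := congrFun heq 0
    simpa only [hb0] using h
  have h1 := key 0
  rw [cosetMean_zero μ hN, toeplitzHankel_zero, mul_one] at h1
  rw [key, ← h1, one_mul]

end Comparison

/-- The average over the coset `O⁻(N+1)`, `N = 2m`, of `∏_i det(1 - a_i u)` equals
`g(-1) · det (φ_{j-k} + φ_{j+k+1})_{0 ≤ j,k < m}`. -/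
theorem ominus_average_eq_toeplitz_plus_hankel (m : ℕ) (hm : 1 ≤ m) (N : ℕ) (hN : N = 2 * m)
    (k : ℕ) (a : Fin k → ℂ)
    (μ : Measure (Matrix.orthogonalGroup (Fin (N + 1)) ℝ))
    [IsProbabilityMeasure μ] [μ.IsHaarMeasure] :
    (2 : ℂ) * (∫ u : Matrix.orthogonalGroup (Fin (N + 1)) ℝ,
        ({u : Matrix.orthogonalGroup (Fin (N + 1)) ℝ |
            (u : Matrix (Fin (N + 1)) (Fin (N + 1)) ℝ).det = -1}.indicator
          (fun u => ∏ i : Fin k,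
            ((1 : Matrix (Fin (N + 1)) (Fin (N + 1)) ℂ) - a i • toC u).det)) u ∂μ)
      = (∏ i : Fin k, (1 + a i)) *
        (Matrix.of fun j k' : Fin m =>
          fCoeff (phiGG a) (((j : ℕ) : ℤ) - ((k' : ℕ) : ℤ)) +
            fCoeff (phiGG a) (((j : ℕ) : ℤ) + ((k' : ℕ) : ℤ) + 1)).det := by
  subst hN
  have h := cosetMean_eq_toeplitzHankel m μ a
  rw [cosetMean, toeplitzHankel] at h
  rw [← h, ← integral_const_mul]
  refine integral_congr_ae (Filter.Eventually.of_forall fun u => ?_)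
  rcases det_eq_one_or_neg_one_of_orthogonal u with hu | hu
  · have hu' : u ∉ {u : Matrix.orthogonalGroup (Fin (2 * m + 1)) ℝ |
        (u : Matrix (Fin (2 * m + 1)) (Fin (2 * m + 1)) ℝ).det = -1} := by
      rw [Set.mem_ofPred_eq, hu]
      norm_num
    simp only [Set.indicator_of_notMem hu', hu]
    simp
  · have hu' : u ∈ {u : Matrix.orthogonalGroup (Fin (2 * m + 1)) ℝ |
        (u : Matrix (Fin (2 * m + 1)) (Fin (2 * m + 1)) ℝ).det = -1} := hu
    simp only [Set.indicator_of_mem hu', hu]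
    norm_num
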